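/- arXiv:1904.09253 — 2 statements merged into one kernel-verified Lean document; each statement's English description precedes it below -/
import Mathlib

section
/- Let a, b > 0 and let ℓ be the critical length of the operator (D²−a²)(D²+b²) = D⁴ + (b²−a²)D² − a²b², whose four-dimensional kernel is spanned by cosh(ax), sinh(ax), cos(bx), sin(bx). Then ℓ lies in the open interval (π/b, 2π/b) and ℓ is the unique x in (π/b, 2π/b) satisfying (b²−a²)·sinh(ax)·sin(bx) = 2ab·(1 − cosh(ax)·cos(bx)). -/
open scoped BigOperators

noncomputable section

/-- `F` vanishes to order at least `m` at `x`: all derivatives of order `< m` vanish at `x`. -/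
def VanishAtLeast (F : ℝ → ℝ) (m : ℕ) (x : ℝ) : Prop :=
  ∀ j < m, iteratedDeriv j F x = 0

/-- `F` vanishes at most `N` times in `J`, counting multiplicities up to `μ`. -/
def VanishAtMost (F : ℝ → ℝ) (μ N : ℕ) (J : Set ℝ) : Prop :=
  ∀ (r : ℕ) (xs : Fin r → ℝ) (m : Fin r → ℕ),
    (∀ i, xs i ∈ J) → Function.Injective xs →
    (∀ i, 1 ≤ m i) → (∀ i, m i ≤ μ) →
    (∀ i, VanishAtLeast F (m i) (xs i)) →
    ∑ i, m i ≤ N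

/-- Kernel of the operator `L = D^(n+1) + ∑_{i=0}^n a i • D^i`. -/
def kerOp (n : ℕ) (a : Fin (n + 1) → ℝ) : Set (ℝ → ℝ) :=
  {F | ContDiff ℝ (⊤ : ℕ∞) F ∧
    ∀ x : ℝ, iteratedDeriv (n + 1) F x + ∑ i : Fin (n + 1), a i * iteratedDeriv (i : ℕ) F x = 0}

/-- The (restriction of the) kernel of `L` is an Extended Chebyshev space on `J`. -/
def IsECOn (n : ℕ) (a : Fin (n + 1) → ℝ) (J : Set ℝ) : Prop :=
  ∀ F ∈ kerOp n a, F ≠ 0 → VanishAtMost F (n + 1) n J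

/-- Critical length of the operator `L = D^(n+1) + ∑ a i • D^i`, as an extended real. -/
def critLen (n : ℕ) (a : Fin (n + 1) → ℝ) : EReal :=
  sSup {l : EReal | ∃ h : ℝ, l = (h : EReal) ∧ 0 < h ∧ IsECOn n a (Set.Icc 0 h)}

/-- Multiplicity-counting zero bound, or identically zero. -/
def AM (I : Set ℝ) (f : ℝ → ℝ) (N : ℕ) : Prop :=
  (∀ x ∈ I, f x = 0) ∨ ∀ (S : Finset ℝ) (m : ℝ → ℕ), (∀ x ∈ S, x ∈ I) →
    (∀ x ∈ S, VanishAtLeast f (m x) x) → ∑ x ∈ S, m x ≤ N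

lemma rolle_mult (I : Set ℝ) [I.OrdConnected] (f p : ℝ → ℝ)
    (h1 : ∀ x ∈ I, ∀ m, VanishAtLeast f (m + 1) x → VanishAtLeast p m x)
    (h2 : ∀ x ∈ I, ∀ y ∈ I, x < y → f x = 0 → f y = 0 → ∃ z ∈ Set.Ioo x y, p z = 0)
    (m : ℝ → ℕ) (S : Finset ℝ) : S.Nonempty → (∀ x ∈ S, x ∈ I) → (∀ x ∈ S, 1 ≤ m x) →
    (∀ x ∈ S, VanishAtLeast f (m x) x) →
    ∃ (S' : Finset ℝ) (m' : ℝ → ℕ), (∀ x ∈ S', x ∈ I) ∧ (∀ x ∈ S', VanishAtLeast p (m' x) x) ∧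
      (∀ z ∈ S', ∃ x ∈ S, z ≤ x) ∧ ∑ x ∈ S', m' x + 1 = ∑ x ∈ S, m x := by
  have zero_of : ∀ x, ∀ k, 1 ≤ k → VanishAtLeast f k x → f x = 0 := by
    intro x k hk h
    simpa using h 0 (by omega)
  have pred : ∀ x ∈ I, ∀ k, 1 ≤ k → VanishAtLeast f k x → VanishAtLeast p (k - 1) x := by
    intro x hx k hk h
    apply h1 x hx
    rwa [Nat.sub_add_cancel hk]
  induction S using Finset.induction_on_max with
  | empty => intro h; exact absurd h (by simp)
  | insert c s hc ih =>
    intro _ hI hm hv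
    have hcI : c ∈ I := hI c (by simp)
    have hcm := hm c (by simp)
    have hcv := hv c (by simp)
    have hcs : c ∉ s := fun h => lt_irrefl _ (hc c h)
    rcases s.eq_empty_or_nonempty with rfl | hs
    · refine ⟨{c}, fun _ => m c - 1, ?_, ?_, ?_, ?_⟩
      · simpa using hcI
      · simpa using pred c hcI _ hcm hcv
      · simp
      · simp; omega
    · obtain ⟨S', m', hS'I, hS'v, hS'x, hsum⟩ := ih hs (fun x hx => hI x (by simp [hx]))
        (fun x hx => hm x (by simp [hx])) (fun x hx => hv x (by simp [hx]))
      set y := s.max' hs with hy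
      have hys : y ∈ s := s.max'_mem hs
      have hyI := hI y (by simp [hys])
      obtain ⟨z, hz, hpz⟩ := h2 y hyI c hcI (hc y hys)
        (zero_of y _ (hm y (by simp [hys])) (hv y (by simp [hys]))) (zero_of c _ hcm hcv)
      have hle : ∀ x ∈ S', x ≤ y := by
        intro x hx
        obtain ⟨w, hw, hxw⟩ := hS'x x hx
        exact hxw.trans (s.le_max' w hw)
      have hzS : z ∉ S' := fun h => absurd (hle z h) (not_le.2 hz.1)
      have hcS : c ∉ S' := fun h => absurd (hle c h) (not_le.2 (hc y hys))
      have hcz : c ≠ z := hz.2.ne'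
      have hzI : z ∈ I := Set.OrdConnected.out ‹_› hyI hcI ⟨hz.1.le, hz.2.le⟩
      have hS'n : ∀ x ∈ S', x ≠ c ∧ x ≠ z := fun x hx =>
        ⟨fun h => hcS (h ▸ hx), fun h => hzS (h ▸ hx)⟩
      refine ⟨insert c (insert z S'),
        fun x => if x = c then m c - 1 else if x = z then 1 else m' x, ?_, ?_, ?_, ?_⟩
      · intro x hx
        simp only [Finset.mem_insert] at hx
        rcases hx with rfl | rfl | hx
        exacts [hcI, hzI, hS'I x hx]
      · intro x hx
        simp only [Finset.mem_insert] at hx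
        rcases hx with rfl | rfl | hx
        · simpa using pred _ hcI _ hcm hcv
        · simp only [hcz.symm, if_false, if_true]
          intro j hj
          obtain rfl : j = 0 := by omega
          simpa using hpz
        · simp only [(hS'n x hx).1, (hS'n x hx).2, if_false]
          exact hS'v x hx
      · intro x hx
        simp only [Finset.mem_insert] at hx
        rcases hx with rfl | rfl | hx
        · exact ⟨_, by simp, le_rfl⟩
        · exact ⟨c, by simp, hz.2.le⟩
        · exact ⟨y, by simp [hys], hle x hx⟩
      · rw [Finset.sum_insert (by simp [hcz, hcS]), Finset.sum_insert hzS, Finset.sum_insert hcs,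
          ← hsum]
        have : ∑ x ∈ S', (if x = c then m c - 1 else if x = z then 1 else m' x)
            = ∑ x ∈ S', m' x :=
          Finset.sum_congr rfl fun x hx => by simp [(hS'n x hx).1, (hS'n x hx).2]
        rw [this]
        simp only [if_true, hcz.symm, if_false]
        omega

lemma vanish_mul {f g : ℝ → ℝ} {x : ℝ} {m : ℕ} (hf : ContDiffAt ℝ (⊤ : ℕ∞) f x)
    (hg : ContDiffAt ℝ (⊤ : ℕ∞) g x) (h : VanishAtLeast f m x) :
    VanishAtLeast (fun t => f t * g t) m x := by
  intro j hj
  rw [iteratedDeriv_fun_mul (hf.of_le (by exact_mod_cast le_top)) (hg.of_le (by exact_mod_cast le_top))]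
  apply Finset.sum_eq_zero
  intro i hi
  rw [h i (by simp at hi; omega)]
  simp

lemma AM_step (I : Set ℝ) [I.OrdConnected] (hIo : IsOpen I) (f f' g g' p q : ℝ → ℝ) (N : ℕ)
    (hf : ContDiff ℝ (⊤ : ℕ∞) f) (hf1 : ContDiff ℝ (⊤ : ℕ∞) f') (hg : ContDiff ℝ (⊤ : ℕ∞) g)
    (hg1 : ContDiff ℝ (⊤ : ℕ∞) g') (hq : ContDiff ℝ (⊤ : ℕ∞) q)
    (hf' : ∀ x, HasDerivAt f (f' x) x) (hg' : ∀ x, HasDerivAt g (g' x) x)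
    (hg0 : ∀ x ∈ I, g x ≠ 0) (hq0 : ∀ x ∈ I, q x ≠ 0)
    (hW : ∀ x, f' x * g x - f x * g' x = q x * p x) (hp : AM I p N) : AM I f (N + 1) := by
  have hdiv : ∀ x ∈ I, HasDerivAt (fun t => f t / g t) (q x * p x / g x ^ 2) x := by
    intro x hx
    rw [← hW]
    exact (hf' x).div (hg' x) (hg0 x hx)
  rcases hp with hp | hp
  · by_cases hz : ∃ x0 ∈ I, f x0 = 0
    · left
      obtain ⟨x0, hx0, hfx0⟩ := hz
      intro x hx
      have : f x / g x = f x0 / g x0 := by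
        refine hIo.is_const_of_deriv_eq_zero (f := fun t => f t / g t)
          (Set.ordConnected_iff_uIcc_subset.1 ‹_› |> fun _ => (‹I.OrdConnected›).isPreconnected) ?_ ?_ hx hx0
        · intro y hy
          exact (hdiv y hy).differentiableAt.differentiableWithinAt
        · intro y hy
          rw [(hdiv y hy).deriv, hp y hy]; simp
      rw [hfx0, zero_div, div_eq_zero_iff] at this
      exact this.resolve_right (hg0 x hx)
    · right
      push Not at hz
      intro S m hS hv
      rw [Finset.sum_eq_zero]
      · omega
      · intro x hx
        by_contra hm
        exact hz x (hS x hx) (by simpa using hv x hx 0 (by omega))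
  · right
    intro S m hS hv
    have hder : deriv f = f' := funext fun x => (hf' x).deriv
    have h1 : ∀ x ∈ I, ∀ m, VanishAtLeast f (m + 1) x → VanishAtLeast p m x := by
      intro x hx m h
      have ha : VanishAtLeast f' m x := by
        intro j hj
        have := h (j + 1) (by omega)
        rwa [iteratedDeriv_succ', hder] at this
      have hb : VanishAtLeast f m x := fun j hj => h j (by omega)
      have hc : VanishAtLeast (fun t => f' t * g t - f t * g' t) m x := by
        intro j hj
        have e1 := vanish_mul hf1.contDiffAt hg.contDiffAt ha j hj
        have e2 := vanish_mul hf.contDiffAt hg1.contDiffAt hb j hj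
        rw [iteratedDeriv_fun_sub, e1, e2, sub_zero]
        · exact ((hf1.mul hg).of_le (by exact_mod_cast le_top)).contDiffAt
        · exact ((hf.mul hg1).of_le (by exact_mod_cast le_top)).contDiffAt
      have hd := vanish_mul (((hf1.mul hg).sub (hf.mul hg1)).contDiffAt)
        (hq.contDiffAt.inv (hq0 x hx)) hc
      intro j hj
      rw [← hd j hj]
      apply Filter.EventuallyEq.iteratedDeriv_eq
      filter_upwards [hIo.mem_nhds hx] with t ht
      rw [hW]
      have := hq0 t ht
      simp only [Pi.inv_apply]
      field_simp
    have h2 : ∀ x ∈ I, ∀ y ∈ I, x < y → f x = 0 → f y = 0 → ∃ z ∈ Set.Ioo x y, p z = 0 := by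
      intro x hx y hy hxy hfx hfy
      have hsub : Set.Icc x y ⊆ I := Set.OrdConnected.out ‹_› hx hy
      obtain ⟨z, hz, hz0⟩ := exists_hasDerivAt_eq_zero (f := fun t => f t / g t)
        (f' := fun x => q x * p x / g x ^ 2) hxy
        (fun t ht => (hdiv t (hsub ht)).continuousAt.continuousWithinAt)
        (by simp [hfx, hfy]) (fun t ht => hdiv t (hsub (Set.Ioo_subset_Icc_self ht)))
      have hzI := hsub (Set.Ioo_subset_Icc_self hz)
      refine ⟨z, hz, ?_⟩
      have := hq0 z hzI
      have := hg0 z hzI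
      simp_all
    have hsum : ∑ x ∈ S.filter (fun x => m x ≠ 0), m x = ∑ x ∈ S, m x := Finset.sum_filter_ne_zero S
    rcases (S.filter (fun x => m x ≠ 0)).eq_empty_or_nonempty with he | hne
    · rw [← hsum, he]; simp
    · obtain ⟨S', m', a1, a2, -, a3⟩ := rolle_mult I f p h1 h2 m _ hne
        (fun x hx => hS x (Finset.mem_filter.1 hx).1)
        (fun x hx => Nat.one_le_iff_ne_zero.2 (Finset.mem_filter.1 hx).2)
        (fun x hx => hv x (Finset.mem_filter.1 hx).1)
      rw [← hsum, ← a3]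
      have := hp S' m' a1 a2
      omega

/-- The fundamental function (up to scaling) and its derivatives. -/
def uu0 (a b x : ℝ) : ℝ := Real.sinh (a * x) / a - Real.sin (b * x) / b
def uu1 (a b x : ℝ) : ℝ := Real.cosh (a * x) - Real.cos (b * x)
def uu2 (a b x : ℝ) : ℝ := a * Real.sinh (a * x) + b * Real.sin (b * x)
def uu3 (a b x : ℝ) : ℝ := a ^ 2 * Real.cosh (a * x) + b ^ 2 * Real.cos (b * x)

lemma hlin (a x : ℝ) : HasDerivAt (fun t => a * t) a x := by
  simpa using (hasDerivAt_id x).const_mul a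

lemma uu0_deriv {a b : ℝ} (ha : 0 < a) (hb : 0 < b) (x : ℝ) :
    HasDerivAt (uu0 a b) (uu1 a b x) x := by
  have := ((hlin a x).sinh.div_const a).sub ((hlin b x).sin.div_const b)
  refine this.congr_deriv ?_
  unfold uu1
  field_simp

lemma uu1_deriv (a b x : ℝ) : HasDerivAt (uu1 a b) (uu2 a b x) x := by
  have := ((hlin a x).cosh).sub ((hlin b x).cos)
  refine this.congr_deriv ?_
  unfold uu2
  ring

lemma uu2_deriv (a b x : ℝ) : HasDerivAt (uu2 a b) (uu3 a b x) x := by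
  have := ((hlin a x).sinh.const_mul a).add ((hlin b x).sin.const_mul b)
  refine this.congr_deriv ?_
  unfold uu3
  ring

lemma uu3_deriv {a b : ℝ} (ha : 0 < a) (hb : 0 < b) (x : ℝ) :
    HasDerivAt (uu3 a b) ((a ^ 2 - b ^ 2) * uu2 a b x + a ^ 2 * b ^ 2 * uu0 a b x) x := by
  have := ((hlin a x).cosh.const_mul (a ^ 2)).add ((hlin b x).cos.const_mul (b ^ 2))
  refine this.congr_deriv ?_
  unfold uu2 uu0
  field_simp
  ring

lemma uu0_contDiff (a b : ℝ) : ContDiff ℝ (⊤ : ℕ∞) (uu0 a b) := by unfold uu0; fun_prop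
lemma uu1_contDiff (a b : ℝ) : ContDiff ℝ (⊤ : ℕ∞) (uu1 a b) := by unfold uu1; fun_prop
lemma uu2_contDiff (a b : ℝ) : ContDiff ℝ (⊤ : ℕ∞) (uu2 a b) := by unfold uu2; fun_prop
lemma uu3_contDiff (a b : ℝ) : ContDiff ℝ (⊤ : ℕ∞) (uu3 a b) := by unfold uu3; fun_prop

lemma uu0_pos {a b x : ℝ} (ha : 0 < a) (hb : 0 < b) (hx : 0 < x) : 0 < uu0 a b x := by
  unfold uu0
  have h1 : x < Real.sinh (a * x) / a := by
    rw [lt_div_iff₀ ha, mul_comm]; exact Real.self_lt_sinh_iff.2 (by positivity)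
  have h2 : Real.sin (b * x) / b < x := by
    rw [div_lt_iff₀ hb, mul_comm]; exact Real.sin_lt (by positivity)
  linarith

lemma w_eq {a b : ℝ} (ha : 0 < a) (hb : 0 < b) (x u v w z y : ℝ) (hu : u = uu0 a b x)
    (hv : v = uu1 a b x) (hw : w = uu2 a b x) (hz : z = uu3 a b x)
    (hy : y = (a ^ 2 - b ^ 2) * w + a ^ 2 * b ^ 2 * u) :
    u * (w * y - z ^ 2) - v * (v * y - z * w) + w * (v * z - w ^ 2)
      = -(a ^ 2 + b ^ 2) ^ 2 * u := by
  have h1 := Real.cosh_sq (a * x)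
  have h2 := Real.cos_sq' (b * x)
  have ha' := ha.ne'
  have hb' := hb.ne'
  have hs : Real.sinh (a * x) = a * (Real.sinh (a * x) / a) := by field_simp
  have ht : Real.sin (b * x) = b * (Real.sin (b * x) / b) := by field_simp
  unfold uu0 uu1 uu2 uu3 at *
  set S := Real.sinh (a * x) / a
  set s := Real.sin (b * x) / b
  set C := Real.cosh (a * x)
  set c := Real.cos (b * x)
  rw [hs] at hw h1
  rw [ht] at hw h2
  subst hy hu hv hw hz
  grind

lemma chain {a b l : ℝ} (ha : 0 < a) (hb : 0 < b) (F F1 F2 F3 : ℝ → ℝ)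
    (cF : ContDiff ℝ (⊤ : ℕ∞) F) (cF1 : ContDiff ℝ (⊤ : ℕ∞) F1) (cF2 : ContDiff ℝ (⊤ : ℕ∞) F2)
    (cF3 : ContDiff ℝ (⊤ : ℕ∞) F3)
    (h0 : ∀ x, HasDerivAt F (F1 x) x) (h1 : ∀ x, HasDerivAt F1 (F2 x) x)
    (h2 : ∀ x, HasDerivAt F2 (F3 x) x)
    (h3 : ∀ x, HasDerivAt F3 ((a ^ 2 - b ^ 2) * F2 x + a ^ 2 * b ^ 2 * F x) x)
    (hD : ∀ x ∈ Set.Ioo 0 l, uu0 a b x * uu2 a b x - uu1 a b x ^ 2 < 0) :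
    AM (Set.Ioo 0 l) F 3 := by
  have cu := uu0_contDiff a b
  have cv := uu1_contDiff a b
  have cw := uu2_contDiff a b
  have cz := uu3_contDiff a b
  have du := uu0_deriv ha hb
  have dv := uu1_deriv a b
  have dw := uu2_deriv a b
  have dz := uu3_deriv ha hb
  have hupos : ∀ x ∈ Set.Ioo 0 l, uu0 a b x ≠ 0 := fun x hx => (uu0_pos ha hb hx.1).ne'
  have hweq := fun x => w_eq ha hb x _ _ _ _ _ rfl rfl rfl rfl rfl
  set u := uu0 a b
  set v := uu1 a b
  set w := uu2 a b
  set z := uu3 a b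
  set P := a ^ 2 - b ^ 2 with hP
  set Q := a ^ 2 * b ^ 2 with hQ
  set y : ℝ → ℝ := fun x => P * w x + Q * u x with hy
  have cy : ContDiff ℝ (⊤ : ℕ∞) y := by fun_prop
  have dy : ∀ x, HasDerivAt y (P * z x + Q * v x) x := fun x =>
    ((dw x).const_mul P).add ((du x).const_mul Q)
  let g : ℝ → ℝ := fun x => u x * (w x * y x - z x ^ 2) - v x * (v x * y x - z x * w x)
    + w x * (v x * z x - w x ^ 2)
  let g' : ℝ → ℝ := fun x => u x * (w x * (P * z x + Q * v x) - z x * y x)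
    - v x * (v x * (P * z x + Q * v x) - z x * z x) + w x * (v x * y x - w x * z x)
  have dg : ∀ x, HasDerivAt g (g' x) x := by
    intro x
    have := (((du x).mul (((dw x).mul (dy x)).sub ((dz x).pow 2))).sub
      ((dv x).mul (((dv x).mul (dy x)).sub ((dz x).mul (dw x))))).add
      ((dw x).mul (((dv x).mul (dz x)).sub ((dw x).pow 2)))
    refine this.congr_deriv ?_
    simp [g', hy]
    ring
  let W3 : ℝ → ℝ := fun x => F3 x * g x - F2 x * g' x
    + F1 x * (u x * (z x * (P * z x + Q * v x) - y x ^ 2)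
      - v x * (w x * (P * z x + Q * v x) - z x * y x) + w x * (w x * y x - z x * z x))
    - F x * (v x * (z x * (P * z x + Q * v x) - y x ^ 2)
      - w x * (w x * (P * z x + Q * v x) - z x * y x) + z x * (w x * y x - z x * z x))
  have dW3 : ∀ x, HasDerivAt W3 0 x := by
    intro x
    have d5 : HasDerivAt (fun x => P * z x + Q * v x) (P * y x + Q * w x) x :=
      ((dz x).const_mul P).add ((dv x).const_mul Q)
    have dg' : HasDerivAt g' _ x := (((du x).mul (((dw x).mul d5).sub ((dz x).mul (dy x)))).sub
      ((dv x).mul (((dv x).mul d5).sub ((dz x).mul (dz x))))).add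
      ((dw x).mul (((dv x).mul (dy x)).sub ((dw x).mul (dz x))))
    have := ((((h3 x).mul (dg x)).sub ((h2 x).mul dg')).add ((h1 x).mul
      ((((du x).mul (((dz x).mul d5).sub ((dy x).pow 2))).sub
      ((dv x).mul (((dw x).mul d5).sub ((dz x).mul (dy x))))).add
      ((dw x).mul (((dw x).mul (dy x)).sub ((dz x).mul (dz x))))))).sub ((h0 x).mul
      ((((dv x).mul (((dz x).mul d5).sub ((dy x).pow 2))).sub
      ((dw x).mul (((dw x).mul d5).sub ((dz x).mul (dy x))))).add
      ((dz x).mul (((dw x).mul (dy x)).sub ((dz x).mul (dz x))))))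
    refine this.congr_deriv ?_
    simp [g', g, hy]
    ring
  have hW3 : AM (Set.Ioo 0 l) W3 0 := by
    have hc : ∀ x t, W3 x = W3 t := fun x t =>
      is_const_of_deriv_eq_zero (fun x => (dW3 x).differentiableAt) (fun x => (dW3 x).deriv) x t
    by_cases hz : W3 0 = 0
    · left
      intro x _
      rw [hc x 0, hz]
    · right
      intro S m hS hv
      rw [Finset.sum_eq_zero]
      intro x hx
      by_contra hm
      exact hz ((hc 0 x).trans (by simpa using hv x hx 0 (by omega)))
  let D : ℝ → ℝ := fun x => u x * w x - v x ^ 2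
  have dD : ∀ x, HasDerivAt D (u x * z x - v x * w x) x := by
    intro x
    refine (((du x).mul (dw x)).sub ((dv x).pow 2)).congr_deriv ?_
    simp
    ring
  let W2 : ℝ → ℝ := fun x => F x * (v x * z x - w x ^ 2) - F1 x * (u x * z x - v x * w x)
    + F2 x * (u x * w x - v x ^ 2)
  let W2' : ℝ → ℝ := fun x => F x * (v x * y x - w x * z x) - F1 x * (u x * y x - v x * z x)
    + F3 x * (u x * w x - v x ^ 2)
  have dW2 : ∀ x, HasDerivAt W2 (W2' x) x := by
    intro x
    have := (((h0 x).mul (((dv x).mul (dz x)).sub ((dw x).pow 2))).sub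
      ((h1 x).mul (((du x).mul (dz x)).sub ((dv x).mul (dw x))))).add
      ((h2 x).mul (((du x).mul (dw x)).sub ((dv x).pow 2)))
    refine this.congr_deriv ?_
    simp [W2', hy]
    ring
  let W1 : ℝ → ℝ := fun x => F1 x * u x - F x * v x
  have dW1 : ∀ x, HasDerivAt W1 (F2 x * u x - F x * w x) x := by
    intro x
    refine (((h1 x).mul (du x)).sub ((h0 x).mul (dv x))).congr_deriv ?_
    ring
  have hDne : ∀ x ∈ Set.Ioo 0 l, D x ≠ 0 := fun x hx => (hD x hx).ne
  have s2 : AM (Set.Ioo 0 l) W2 1 := by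
    refine AM_step _ isOpen_Ioo W2 W2' g g' W3 D 0 (by fun_prop) (by fun_prop) (by fun_prop)
      (by fun_prop) (by fun_prop) dW2 dg ?_ hDne ?_ hW3
    · intro x hx
      rw [show g x = _ from hweq x]
      have := hupos x hx
      have : 0 < a ^ 2 + b ^ 2 := by positivity
      exact mul_ne_zero (neg_ne_zero.2 (by positivity)) (hupos x hx)
    · intro x
      simp only [W2', W2, W3, g, g', D]
      ring
  have s1 : AM (Set.Ioo 0 l) W1 2 := by
    refine AM_step _ isOpen_Ioo W1 _ D _ W2 u 1 (by fun_prop) ?_ (by fun_prop)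
      ?_ (by fun_prop) dW1 dD hDne hupos ?_ s2
    · fun_prop
    · fun_prop
    · intro x
      simp only [W2, W1, D]
      ring
  refine AM_step _ isOpen_Ioo F F1 u v W1 (fun _ => 1) 2 cF cF1 cu cv contDiff_const h0 du hupos
    (by simp) ?_ s1
  intro x
  simp [W1]

lemma ker_unique {a b : ℝ} (hb : 0 < b) (F F1 F2 F3 : ℝ → ℝ)
    (h0 : ∀ x, HasDerivAt F (F1 x) x) (h1 : ∀ x, HasDerivAt F1 (F2 x) x)
    (h2 : ∀ x, HasDerivAt F2 (F3 x) x)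
    (h3 : ∀ x, HasDerivAt F3 ((a ^ 2 - b ^ 2) * F2 x + a ^ 2 * b ^ 2 * F x) x)
    (c : ℝ) (e0 : F c = 0) (e1 : F1 c = 0) (e2 : F2 c = 0) (e3 : F3 c = 0) : F = 0 := by
  have const : ∀ G : ℝ → ℝ, (∀ x, HasDerivAt G 0 x) → ∀ x, G x = G c := fun G hG x =>
    is_const_of_deriv_eq_zero (fun x => (hG x).differentiableAt) (fun x => (hG x).deriv) x c
  have hE : ∀ x, F2 x - a ^ 2 * F x = 0 := by
    intro x
    have := const (fun x => (F3 x - a ^ 2 * F1 x) ^ 2 + b ^ 2 * (F2 x - a ^ 2 * F x) ^ 2) (by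
      intro x
      refine ((((h3 x).sub ((h1 x).const_mul (a ^ 2))).pow 2).add
        ((((h2 x).sub ((h0 x).const_mul (a ^ 2))).pow 2).const_mul (b ^ 2))).congr_deriv ?_
      simp
      ring) x
    simp only [e0, e1, e2, e3] at this
    have h5 : b ^ 2 * (F2 x - a ^ 2 * F x) ^ 2 = 0 := by
      have := sq_nonneg (F3 x - a ^ 2 * F1 x)
      have : 0 ≤ b ^ 2 * (F2 x - a ^ 2 * F x) ^ 2 := by positivity
      nlinarith
    simpa [hb.ne'] using h5
  have hexp : ∀ k x : ℝ, HasDerivAt (fun t => Real.exp (k * t)) (Real.exp (k * x) * k) x :=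
    fun k x => (hlin k x).exp
  have hH : ∀ x, F1 x + a * F x = 0 := by
    intro x
    have := const (fun x => (F1 x + a * F x) * Real.exp (-a * x)) (by
      intro x
      refine (((h1 x).add ((h0 x).const_mul a)).mul (hexp (-a) x)).congr_deriv ?_
      simp only [Pi.add_apply]
      linear_combination Real.exp (-a * x) * hE x) x
    simpa [e0, e1] using this
  funext x
  have := const (fun x => F x * Real.exp (a * x)) (by
      intro x
      refine ((h0 x).mul (hexp a x)).congr_deriv ?_
      linear_combination Real.exp (a * x) * hH x) x
  simpa [e0] using this

lemma E_eq {a b : ℝ} (ha : 0 < a) (hb : 0 < b) (x : ℝ) :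
    a * b * (uu0 a b x * uu2 a b x - uu1 a b x ^ 2) =
      (b ^ 2 - a ^ 2) * Real.sinh (a * x) * Real.sin (b * x) -
        2 * a * b * (1 - Real.cosh (a * x) * Real.cos (b * x)) := by
  have h1 := Real.cosh_sq (a * x)
  have h2 := Real.cos_sq' (b * x)
  unfold uu0 uu1 uu2
  field_simp
  linear_combination (-a * b) * h1 - a * b * h2

lemma E_deriv {a b : ℝ} (ha : 0 < a) (hb : 0 < b) (x : ℝ) :
    HasDerivAt (fun x => uu0 a b x * uu2 a b x - uu1 a b x ^ 2)
      ((a ^ 2 + b ^ 2) * (Real.sinh (a * x) * Real.cos (b * x) / a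
        - Real.cosh (a * x) * Real.sin (b * x) / b)) x := by
  refine (((uu0_deriv ha hb x).mul (uu2_deriv a b x)).sub ((uu1_deriv a b x).pow 2)).congr_deriv ?_
  unfold uu0 uu1 uu2 uu3
  field_simp
  ring

lemma T_deriv {a b : ℝ} (ha : 0 < a) (hb : 0 < b) (x : ℝ) :
    HasDerivAt (fun x => Real.sinh (a * x) * Real.cos (b * x) / a
        - Real.cosh (a * x) * Real.sin (b * x) / b)
      (-((a ^ 2 + b ^ 2) / (a * b) * Real.sinh (a * x) * Real.sin (b * x))) x := by
  refine ((((hlin a x).sinh.mul (hlin b x).cos).div_const a).sub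
    (((hlin a x).cosh.mul (hlin b x).sin).div_const b)).congr_deriv ?_
  field_simp
  ring

lemma E_facts {a b : ℝ} (ha : 0 < a) (hb : 0 < b) :
    ∃ l ∈ Set.Ioo (Real.pi / b) (2 * Real.pi / b),
      uu0 a b l * uu2 a b l - uu1 a b l ^ 2 = 0 ∧
      (∀ x ∈ Set.Ioo 0 l, uu0 a b x * uu2 a b x - uu1 a b x ^ 2 < 0) ∧
      ∀ x ∈ Set.Ioo (Real.pi / b) (2 * Real.pi / b),
        uu0 a b x * uu2 a b x - uu1 a b x ^ 2 = 0 → x = l := by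
  have hpi := Real.pi_pos
  have hE := E_deriv ha hb
  have hT := T_deriv ha hb
  have hab : 0 < a * b := by positivity
  have hEp : uu0 a b (Real.pi / b) * uu2 a b (Real.pi / b) - uu1 a b (Real.pi / b) ^ 2 < 0 := by
    have h := E_eq ha hb (Real.pi / b)
    rw [mul_div_cancel₀ _ hb.ne', Real.sin_pi, Real.cos_pi] at h
    have := Real.cosh_pos (a * (Real.pi / b))
    by_contra hc
    have := mul_nonneg hab.le (not_lt.1 hc)
    nlinarith
  have hEq : 0 < uu0 a b (2 * Real.pi / b) * uu2 a b (2 * Real.pi / b)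
      - uu1 a b (2 * Real.pi / b) ^ 2 := by
    have h := E_eq ha hb (2 * Real.pi / b)
    rw [mul_div_cancel₀ _ hb.ne', Real.sin_two_pi, Real.cos_two_pi] at h
    have : 1 < Real.cosh (a * (2 * Real.pi / b)) := Real.one_lt_cosh.2 (by positivity)
    by_contra hc
    have := mul_nonneg hab.le (neg_nonneg.2 (not_lt.1 hc))
    nlinarith
  have hE0 : uu0 a b 0 * uu2 a b 0 - uu1 a b 0 ^ 2 = 0 := by simp [uu0, uu1, uu2]
  have hT0 : Real.sinh (a * 0) * Real.cos (b * 0) / a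
        - Real.cosh (a * 0) * Real.sin (b * 0) / b = 0 := by simp
  set E : ℝ → ℝ := fun x => uu0 a b x * uu2 a b x - uu1 a b x ^ 2 with hEdef
  set T : ℝ → ℝ := fun x => Real.sinh (a * x) * Real.cos (b * x) / a
        - Real.cosh (a * x) * Real.sin (b * x) / b with hTdef
  have cE : Continuous E := continuous_iff_continuousAt.2 fun x => (hE x).continuousAt
  have cT : Continuous T := continuous_iff_continuousAt.2 fun x => (hT x).continuousAt
  have hp0 : 0 < Real.pi / b := by positivity
  have hpq : Real.pi / b < 2 * Real.pi / b := by gcongr; linarith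
  have hTneg : ∀ x ∈ Set.Ioo 0 (Real.pi / b), T x < 0 := by
    have hanti : StrictAntiOn T (Set.Icc 0 (Real.pi / b)) := by
      apply strictAntiOn_of_deriv_neg (convex_Icc _ _) cT.continuousOn
      intro x hx
      rw [interior_Icc] at hx
      rw [(hT x).deriv]
      have h1 : 0 < Real.sinh (a * x) := Real.sinh_pos_iff.2 (mul_pos ha hx.1)
      have h2 : 0 < Real.sin (b * x) := Real.sin_pos_of_pos_of_lt_pi (mul_pos hb hx.1)
        (by rw [mul_comm]; exact (lt_div_iff₀ hb).1 hx.2)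
      have : 0 < (a ^ 2 + b ^ 2) / (a * b) * Real.sinh (a * x) * Real.sin (b * x) := by positivity
      linarith
    intro x hx
    have := hanti ⟨le_rfl, hp0.le⟩ ⟨hx.1.le, hx.2.le⟩ hx.1
    exact this.trans_eq hT0
  have hEneg : ∀ x ∈ Set.Ioc 0 (Real.pi / b), E x < 0 := by
    have hanti : StrictAntiOn E (Set.Icc 0 (Real.pi / b)) := by
      apply strictAntiOn_of_deriv_neg (convex_Icc _ _) cE.continuousOn
      intro x hx
      rw [interior_Icc] at hx
      rw [(hE x).deriv]
      exact mul_neg_of_pos_of_neg (by positivity) (hTneg x hx)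
    intro x hx
    have := hanti ⟨le_rfl, hp0.le⟩ ⟨hx.1.le, hx.2⟩ hx.1
    exact this.trans_eq hE0
  have hTmono : MonotoneOn T (Set.Icc (Real.pi / b) (2 * Real.pi / b)) := by
    apply monotoneOn_of_deriv_nonneg (convex_Icc _ _) cT.continuousOn
    · intro x _
      exact (hT x).differentiableAt.differentiableWithinAt
    · intro x hx
      rw [interior_Icc] at hx
      rw [(hT x).deriv]
      have h1 : 0 < Real.sinh (a * x) := Real.sinh_pos_iff.2 (mul_pos ha (hp0.trans hx.1))
      have h3 : Real.pi < b * x := by rw [mul_comm]; exact (div_lt_iff₀ hb).1 hx.1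
      have h4 : b * x < 2 * Real.pi := by rw [mul_comm]; exact (lt_div_iff₀ hb).1 hx.2
      have h2 : Real.sin (b * x) < 0 := by
        have := Real.sin_pos_of_pos_of_lt_pi (x := b * x - Real.pi) (by linarith) (by linarith)
        rw [Real.sin_sub_pi] at this
        linarith
      have : 0 < (a ^ 2 + b ^ 2) / (a * b) * Real.sinh (a * x) := by positivity
      nlinarith
  have hconv : ConvexOn ℝ (Set.Icc (Real.pi / b) (2 * Real.pi / b)) E := by
    apply MonotoneOn.convexOn_of_deriv (convex_Icc _ _) cE.continuousOn
    · intro x _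
      exact (hE x).differentiableAt.differentiableWithinAt
    · intro x hx y hy hxy
      rw [(hE x).deriv, (hE y).deriv]
      exact mul_le_mul_of_nonneg_left (hTmono (interior_subset hx) (interior_subset hy) hxy)
        (by positivity)
  have key : ∀ x y, Real.pi / b < x → x < y → y < 2 * Real.pi / b → E y = 0 → E x < 0 := by
    intro x y hx hxy hy hy0
    by_contra hc
    have := hconv.lt_right_of_left_lt (x := Real.pi / b) (y := y) (z := x) ⟨le_rfl, hpq.le⟩
      ⟨(hx.trans hxy).le, hy.le⟩ (by rw [openSegment_eq_Ioo (hx.trans hxy)]; exact ⟨hx, hxy⟩)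
      (hEp.trans_le (not_lt.1 hc))
    exact hc (this.trans_eq hy0)
  obtain ⟨l, hl, hl0⟩ := intermediate_value_Ioo hpq.le cE.continuousOn (show (0:ℝ) ∈ Set.Ioo _ _ from ⟨hEp, hEq⟩)
  refine ⟨l, hl, hl0, ?_, ?_⟩
  · intro x hx
    rcases le_or_gt x (Real.pi / b) with h | h
    · exact hEneg x ⟨hx.1, h⟩
    · exact key x l h hx.2 hl.2 hl0
  · intro x hx hx0
    rcases lt_trichotomy x l with h | h | h
    · exact absurd hx0 (key x l hx.1 h hl.2 hl0).ne
    · exact h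
    · exact absurd hl0 (key l x hl.1 h hx.2 hx0).ne

lemma ker_data {a b : ℝ} {F : ℝ → ℝ} (hF : F ∈ kerOp 3 ![-(a ^ 2 * b ^ 2), 0, b ^ 2 - a ^ 2, 0]) :
    (∀ n, ContDiff ℝ (⊤ : ℕ∞) (iteratedDeriv n F)) ∧
    (∀ n x, HasDerivAt (iteratedDeriv n F) (iteratedDeriv (n + 1) F x) x) ∧
    ∀ x, iteratedDeriv 4 F x =
      (a ^ 2 - b ^ 2) * iteratedDeriv 2 F x + a ^ 2 * b ^ 2 * iteratedDeriv 0 F x := by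
  have h1 : ∀ n, ContDiff ℝ (⊤ : ℕ∞) (iteratedDeriv n F) := by
    intro n
    rw [iteratedDeriv_eq_iterate]
    exact hF.1.iterate_deriv n
  refine ⟨h1, ?_, ?_⟩
  · intro n x
    rw [iteratedDeriv_succ]
    exact ((h1 n).differentiable (by simp) x).hasDerivAt
  · intro x
    have := hF.2 x
    simp [Fin.sum_univ_four] at this
    simp
    linarith

lemma ec_of_lt {a b l h : ℝ} (ha : 0 < a) (hb : 0 < b) (hl : h < l) (h0 : 0 < h)
    (hD : ∀ x ∈ Set.Ioo 0 l, uu0 a b x * uu2 a b x - uu1 a b x ^ 2 < 0) :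
    IsECOn 3 ![-(a ^ 2 * b ^ 2), 0, b ^ 2 - a ^ 2, 0] (Set.Icc 0 h) := by
  intro F hF hF0 r xs m hxs hinj hm1 hm4 hv
  obtain ⟨e, he⟩ : ∃ e, e = (l - h) / 2 := ⟨_, rfl⟩
  have hG : (fun x => F (x - e)) ∈ kerOp 3 ![-(a ^ 2 * b ^ 2), 0, b ^ 2 - a ^ 2, 0] := by
    refine ⟨hF.1.comp (contDiff_id.sub contDiff_const), fun x => ?_⟩
    simp only [iteratedDeriv_comp_sub_const]
    exact hF.2 (x - e)
  obtain ⟨c, d, k⟩ := ker_data hG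
  have hAM := chain (l := l) ha hb _ _ _ _ (c 0) (c 1) (c 2) (c 3) (d 0) (d 1) (d 2)
    (fun x => by rw [← k x]; exact d 3 x) hD
  simp only [iteratedDeriv_zero] at hAM
  rcases hAM with hz | hz
  · exfalso
    have hev : ∀ n, iteratedDeriv n (fun x => F (x - e)) (l / 2) = 0 := by
      intro n
      have : (fun x => F (x - e)) =ᶠ[nhds (l / 2)] fun _ => 0 := by
        filter_upwards [isOpen_Ioo.mem_nhds (show l / 2 ∈ Set.Ioo 0 l from
          ⟨by linarith, by linarith⟩)] with x hx using hz x hx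
      rw [this.iteratedDeriv_eq]
      simp
    have := ker_unique hb _ _ _ _ (d 0) (d 1) (d 2)
      (fun x => by rw [← k x]; exact d 3 x) (l / 2) (hev 0) (hev 1) (hev 2) (hev 3)
    apply hF0
    funext x
    have := congrFun this (x + e)
    simpa using this
  · have hinj' : Function.Injective (fun i => xs i + e) := fun i j hij => hinj (by simpa using hij)
    have := hz (Finset.univ.map ⟨fun i => xs i + e, hinj'⟩)
      (fun x => ∑ i, if xs i + e = x then m i else 0) ?_ ?_
    · rw [Finset.sum_map] at this
      simp only [Function.Embedding.coeFn_mk, add_left_inj] at this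
      refine le_trans (le_of_eq ?_) this
      refine Finset.sum_congr rfl fun i _ => ?_
      simp [hinj.eq_iff]
    · intro x hx
      simp only [Finset.mem_map, Finset.mem_univ, true_and, Function.Embedding.coeFn_mk] at hx
      obtain ⟨i, rfl⟩ := hx
      have := hxs i
      constructor <;> linarith [this.1, this.2]
    · intro x hx
      simp only [Finset.mem_map, Finset.mem_univ, true_and, Function.Embedding.coeFn_mk] at hx
      obtain ⟨i, rfl⟩ := hx
      simp only [add_left_inj, hinj.eq_iff, Finset.sum_ite_eq', Finset.mem_univ, if_true]
      intro j hj
      rw [iteratedDeriv_comp_sub_const]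
      simpa using hv i j hj

lemma not_ec {a b l h : ℝ} (ha : 0 < a) (hb : 0 < b) (hl0 : 0 < l) (hl : l ≤ h)
    (hD : uu0 a b l * uu2 a b l - uu1 a b l ^ 2 = 0) :
    ¬ IsECOn 3 ![-(a ^ 2 * b ^ 2), 0, b ^ 2 - a ^ 2, 0] (Set.Icc 0 h) := by
  intro hEC
  set p := uu1 a b l with hp
  set q := uu0 a b l with hq
  have hqpos : 0 < q := uu0_pos ha hb hl0
  let F : ℝ → ℝ := fun x => p * uu0 a b x - q * uu1 a b x
  let F1 : ℝ → ℝ := fun x => p * uu1 a b x - q * uu2 a b x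
  let F2 : ℝ → ℝ := fun x => p * uu2 a b x - q * uu3 a b x
  let F3 : ℝ → ℝ := fun x => p * uu3 a b x
    - q * ((a ^ 2 - b ^ 2) * uu2 a b x + a ^ 2 * b ^ 2 * uu0 a b x)
  have d0 : deriv F = F1 := funext fun x =>
    (((uu0_deriv ha hb x).const_mul p).sub ((uu1_deriv a b x).const_mul q)).deriv
  have d1 : deriv F1 = F2 := funext fun x =>
    (((uu1_deriv a b x).const_mul p).sub ((uu2_deriv a b x).const_mul q)).deriv
  have d2 : deriv F2 = F3 := funext fun x =>
    (((uu2_deriv a b x).const_mul p).sub ((uu3_deriv ha hb x).const_mul q)).deriv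
  have d3 : deriv F3 = fun x => (a ^ 2 - b ^ 2) * F2 x + a ^ 2 * b ^ 2 * F x := funext fun x => by
    have := (((uu3_deriv ha hb x).const_mul p).sub ((((uu2_deriv a b x).const_mul
      (a ^ 2 - b ^ 2)).add ((uu0_deriv ha hb x).const_mul (a ^ 2 * b ^ 2))).const_mul q)).deriv
    refine this.trans ?_
    simp only [F2, F]
    ring
  have hker : F ∈ kerOp 3 ![-(a ^ 2 * b ^ 2), 0, b ^ 2 - a ^ 2, 0] := by
    refine ⟨(contDiff_const.mul (uu0_contDiff a b)).sub (contDiff_const.mul (uu1_contDiff a b)), ?_⟩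
    intro x
    simp [Fin.sum_univ_four, iteratedDeriv_succ', d0, d1, d2, d3]
    ring
  have hne : F ≠ 0 := by
    intro h0
    have e1 : F1 = 0 := by rw [← d0, h0]; funext x; simp
    have e2 : F2 = 0 := by rw [← d1, e1]; funext x; simp
    have := congrFun e2 0
    simp [F2, uu2, uu3] at this
    have : 0 < a ^ 2 + b ^ 2 := by positivity
    grind
  have := hEC F hker hne 2 ![0, l] ![2, 2] ?_ ?_ ?_ ?_ ?_
  · simp [Fin.sum_univ_two] at this
  · intro i
    fin_cases i
    · simp; linarith
    · simp; constructor <;> linarith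
  · intro i j
    fin_cases i <;> fin_cases j <;> simp [hl0.ne, hl0.ne']
  · intro i; fin_cases i <;> simp
  · intro i; fin_cases i <;> simp
  · intro i
    fin_cases i
    · intro j hj
      simp at hj
      interval_cases j
      · simp [F, uu0, uu1]
      · simp [iteratedDeriv_one, d0, F1, uu1, uu2]
    · intro j hj
      simp at hj
      interval_cases j
      · simp [F, ← hp, ← hq]; ring
      · simp [iteratedDeriv_one, d0, F1, ← hp]; linarith

/-- for `a, b > 0`, the critical length `ℓ` of `(D² - a²)(D² + b²)`
(kernel spanned by `cosh ax, sinh ax, cos bx, sin bx`) lies in `(π/b, 2π/b)` and is the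
unique solution there of `(b² - a²) sinh(ax) sin(bx) = 2ab (1 - cosh(ax) cos(bx))`. -/
theorem stmt11 (a b : ℝ) (ha : 0 < a) (hb : 0 < b) :
    ∃ ℓ : ℝ, critLen 3 ![-(a ^ 2 * b ^ 2), 0, b ^ 2 - a ^ 2, 0] = (ℓ : EReal) ∧
      ℓ ∈ Set.Ioo (Real.pi / b) (2 * Real.pi / b) ∧
      (b ^ 2 - a ^ 2) * Real.sinh (a * ℓ) * Real.sin (b * ℓ) =
        2 * a * b * (1 - Real.cosh (a * ℓ) * Real.cos (b * ℓ)) ∧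
      ∀ x ∈ Set.Ioo (Real.pi / b) (2 * Real.pi / b),
        (b ^ 2 - a ^ 2) * Real.sinh (a * x) * Real.sin (b * x) =
          2 * a * b * (1 - Real.cosh (a * x) * Real.cos (b * x)) → x = ℓ := by
  obtain ⟨l, hl, hl0, hneg, huniq⟩ := E_facts ha hb
  have hab : 0 < a * b := by positivity
  have hlpos : 0 < l := lt_trans (by positivity) hl.1
  refine ⟨l, ?_, hl, ?_, ?_⟩
  · apply le_antisymm
    · apply sSup_le
      rintro _ ⟨h, rfl, -, hEC⟩
      rw [EReal.coe_le_coe_iff]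
      by_contra hc
      exact not_ec ha hb hlpos (not_le.1 hc).le hl0 hEC
    · apply le_of_forall_lt
      intro c hc
      obtain ⟨h, hch, hhl⟩ := EReal.exists_between_coe_real hc
      have hhl' : h < l := EReal.coe_lt_coe_iff.1 hhl
      have hm : max h (l / 2) < l := max_lt hhl' (by linarith)
      have hm0 : 0 < max h (l / 2) := lt_max_of_lt_right (by linarith)
      refine lt_of_lt_of_le (hch.trans_le (EReal.coe_le_coe_iff.2 (le_max_left h (l / 2)))) ?_
      exact le_sSup ⟨_, rfl, hm0, ec_of_lt ha hb hm hm0 hneg⟩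
  · have := E_eq ha hb l
    rw [hl0, mul_zero] at this
    linarith
  · intro x hx hxe
    apply huniq x hx
    have := E_eq ha hb x
    rw [hxe, sub_self] at this
    exact (mul_eq_zero.1 this).resolve_left hab.ne'
end
end

section
/- Let 0 < a < b with b ≤ 3a, and let ℓ be the critical length of the operator (D²+a²)(D²+b²) = D⁴ + (a²+b²)D² + a²b², whose four-dimensional kernel is spanned by cos(ax), sin(ax), cos(bx), sin(bx). Let S₃ be the kernel element with S₃(0) = S₃'(0) = S₃''(0) = 0 and S₃'''(0) = 1. Then ℓ is the first positive zero of S₃, and ℓ is the only solution x of b·sin(ax) = a·sin(bx) in the closed interval [(π/b)·⌊b/a⌋, (π/b)·⌈b/a⌉]. -/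
open scoped BigOperators

noncomputable section

/-- `F` has at least `N` zeros in `J`, counted with multiplicities. -/
def HasZ (F : ℝ → ℝ) (N : ℕ) (J : Set ℝ) : Prop :=
  ∃ (s : Finset ℝ) (m : ℝ → ℕ), (∀ x ∈ s, x ∈ J) ∧ (∀ x ∈ s, VanishAtLeast F (m x) x) ∧
    N ≤ ∑ x ∈ s, m x

lemma HasZ.exists_zero {F : ℝ → ℝ} {N : ℕ} {J : Set ℝ} (h : HasZ F (N + 1) J) :
    ∃ x ∈ J, F x = 0 := by
  obtain ⟨s, m, hJ, hv, hN⟩ := h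
  have hne : ∑ x ∈ s, m x ≠ 0 := by omega
  obtain ⟨x, hx, hmx⟩ := Finset.exists_ne_zero_of_sum_ne_zero hne
  refine ⟨x, hJ x hx, ?_⟩
  have := hv x hx 0 (Nat.pos_of_ne_zero hmx)
  simpa using this

lemma vanish_mul_s13 {u F : ℝ → ℝ} (hu : ContDiff ℝ (⊤ : ℕ∞) u) (hF : ContDiff ℝ (⊤ : ℕ∞) F)
    {m : ℕ} {x : ℝ} (h : VanishAtLeast F m x) : VanishAtLeast (u * F) m x := by
  intro j hj
  have h1 : ContDiffAt ℝ j u x := (hu.of_le (by exact_mod_cast le_top)).contDiffAt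
  have h2 : ContDiffAt ℝ j F x := (hF.of_le (by exact_mod_cast le_top)).contDiffAt
  rw [iteratedDeriv_mul h1 h2]
  apply Finset.sum_eq_zero
  intro i hi
  rw [h (j - i) (by omega), mul_zero]

lemma vanish_wronsk {u F u' F' : ℝ → ℝ} (hu : ContDiff ℝ (⊤ : ℕ∞) u)
    (hF : ContDiff ℝ (⊤ : ℕ∞) F) (hu' : ContDiff ℝ (⊤ : ℕ∞) u')
    (hF' : ContDiff ℝ (⊤ : ℕ∞) F') (hdF : ∀ x, HasDerivAt F (F' x) x)
    {m : ℕ} {x : ℝ} (h : VanishAtLeast F m x) :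
    VanishAtLeast (fun x => u x * F' x - u' x * F x) (m - 1) x := by
  have hd : deriv F = F' := funext fun x => (hdF x).deriv
  have h1 : VanishAtLeast F' (m - 1) x := by
    intro j hj
    have := h (j + 1) (by omega)
    rwa [iteratedDeriv_succ', hd] at this
  have h2 := vanish_mul_s13 hu hF' h1
  have h3 := vanish_mul_s13 hu' hF h
  intro j hj
  have e : (fun x => u x * F' x - u' x * F x) = u * F' - u' * F := rfl
  have k1 : ContDiffAt ℝ j (u * F') x := ((hu.mul hF').of_le (by exact_mod_cast le_top)).contDiffAt
  have k2 : ContDiffAt ℝ j (u' * F) x := ((hu'.mul hF).of_le (by exact_mod_cast le_top)).contDiffAt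
  rw [e, iteratedDeriv_sub k1 k2, h2 j hj, h3 j (by omega), sub_zero]

lemma rolle_aux {u F u' F' : ℝ → ℝ} (p q : ℝ) (hpq : p < q)
    (hu : ∀ x ∈ Set.Icc p q, u x ≠ 0)
    (hdu : ∀ x, HasDerivAt u (u' x) x) (hdF : ∀ x, HasDerivAt F (F' x) x)
    (hp : F p = 0) (hq : F q = 0) : ∃ c ∈ Set.Ioo p q, u c * F' c - u' c * F c = 0 := by
  have key : ∀ x ∈ Set.Icc p q,
      HasDerivAt (fun x => F x / u x) ((F' x * u x - F x * u' x) / u x ^ 2) x :=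
    fun x hx => (hdF x).div (hdu x) (hu x hx)
  obtain ⟨c, hc, h0⟩ := exists_hasDerivAt_eq_zero hpq
    (fun x hx => (key x hx).continuousAt.continuousWithinAt) (by simp [hp, hq])
    (fun x hx => key x (Set.Ioo_subset_Icc_self hx))
  refine ⟨c, hc, ?_⟩
  have hne := hu c (Set.Ioo_subset_Icc_self hc)
  rw [div_eq_zero_iff] at h0
  rcases h0 with h0 | h0
  · linarith
  · exact absurd h0 (pow_ne_zero 2 hne)

lemma rolle_count {u F u' F' : ℝ → ℝ} {J : Set ℝ} (hJ : J.OrdConnected)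
    (hu : ContDiff ℝ (⊤ : ℕ∞) u)
    (hF : ContDiff ℝ (⊤ : ℕ∞) F) (hu' : ContDiff ℝ (⊤ : ℕ∞) u')
    (hF' : ContDiff ℝ (⊤ : ℕ∞) F') (hdu : ∀ x, HasDerivAt u (u' x) x)
    (hdF : ∀ x, HasDerivAt F (F' x) x) (hne : ∀ x ∈ J, u x ≠ 0) (m : ℝ → ℕ) (s : Finset ℝ) :
    (∀ x ∈ s, x ∈ J) → (∀ x ∈ s, 1 ≤ m x) → (∀ x ∈ s, VanishAtLeast F (m x) x) →
    ∃ (t : Finset ℝ) (m' : ℝ → ℕ), (∀ x ∈ t, x ∈ J) ∧ (∀ y ∈ t, ∃ p ∈ s, y ≤ p) ∧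
      (∀ x ∈ t, VanishAtLeast (fun x => u x * F' x - u' x * F x) (m' x) x) ∧
      ∑ x ∈ s, m x ≤ ∑ x ∈ t, m' x + 1 := by
  classical
  induction s using Finset.induction_on_max with
  | empty =>
    intro _ _ _
    exact ⟨∅, m, by simp, by simp, by simp, by simp⟩
  | insert q s hq ih =>
    intro h1 h2 h3
    have hqJ := h1 q (by simp)
    have hqm := h2 q (by simp)
    have hqv := h3 q (by simp)
    have hwq := vanish_wronsk hu hF hu' hF' hdF hqv
    have hqs : q ∉ s := fun h => lt_irrefl _ (hq q h)
    rcases s.eq_empty_or_nonempty with rfl | hs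
    · refine ⟨{q}, fun _ => m q - 1, by simpa using hqJ, by simp, by simpa using hwq, ?_⟩
      simp; omega
    obtain ⟨t, m', t1, t2, t3, t4⟩ := ih (fun x hx => h1 x (by simp [hx]))
      (fun x hx => h2 x (by simp [hx])) (fun x hx => h3 x (by simp [hx]))
    set p := s.max' hs with hp
    have hps : p ∈ s := s.max'_mem hs
    have hpq : p < q := hq p hps
    have hpJ := h1 p (by simp [hps])
    have hFp : F p = 0 := by simpa using h3 p (by simp [hps]) 0 (h2 p (by simp [hps]))
    have hFq : F q = 0 := by simpa using hqv 0 hqm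
    obtain ⟨c, hc, hc0⟩ := rolle_aux p q hpq (fun x hx => hne x (hJ.out hpJ hqJ hx)) hdu hdF hFp hFq
    have htp : ∀ y ∈ t, y ≤ p := fun y hy => by
      obtain ⟨z, hz, hyz⟩ := t2 y hy
      exact hyz.trans (s.le_max' z hz)
    have hct : c ∉ t := fun h => absurd (htp c h) (not_le.2 hc.1)
    have hqt : q ∉ t := fun h => absurd (htp q h) (not_le.2 hpq)
    have hqc : q ≠ c := hc.2.ne'
    have hqct : q ∉ insert c t := by simp [hqc, hqt]
    refine ⟨insert q (insert c t), fun x => if x = q then m q - 1 else if x = c then 1 else m' x,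
      ?_, ?_, ?_, ?_⟩
    · intro x hx
      simp only [Finset.mem_insert] at hx
      rcases hx with rfl | rfl | hx
      · exact hqJ
      · exact hJ.out hpJ hqJ (Set.Ioo_subset_Icc_self hc)
      · exact t1 x hx
    · intro x hx
      simp only [Finset.mem_insert] at hx
      refine ⟨q, by simp, ?_⟩
      rcases hx with rfl | rfl | hx
      · exact le_rfl
      · exact hc.2.le
      · exact (htp x hx).trans hpq.le
    · intro x hx
      simp only [Finset.mem_insert] at hx
      rcases hx with rfl | rfl | hx
      · simpa using hwq
      · simp only [hqc.symm, if_false, if_true]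
        intro j hj
        obtain rfl : j = 0 := by omega
        simpa using hc0
      · have a1 : x ≠ q := fun h => hqt (h ▸ hx)
        have a2 : x ≠ c := fun h => hct (h ▸ hx)
        simp only [a1, a2, if_false]
        exact t3 x hx
    · rw [Finset.sum_insert hqs, Finset.sum_insert hqct, Finset.sum_insert hct]
      have : ∑ x ∈ t, (if x = q then m q - 1 else if x = c then 1 else m' x) = ∑ x ∈ t, m' x := by
        apply Finset.sum_congr rfl
        intro x hx
        have a1 : x ≠ q := fun h => hqt (h ▸ hx)
        have a2 : x ≠ c := fun h => hct (h ▸ hx)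
        simp [a1, a2]
      rw [this]
      simp only [hqc.symm, if_false, if_true]
      omega

lemma HasZ.step {u F u' F' G : ℝ → ℝ} {J : Set ℝ} {N : ℕ} (h : HasZ F (N + 1) J)
    (hJ : J.OrdConnected)
    (hu : ContDiff ℝ (⊤ : ℕ∞) u)
    (hF : ContDiff ℝ (⊤ : ℕ∞) F) (hu' : ContDiff ℝ (⊤ : ℕ∞) u')
    (hF' : ContDiff ℝ (⊤ : ℕ∞) F') (hdu : ∀ x, HasDerivAt u (u' x) x)
    (hdF : ∀ x, HasDerivAt F (F' x) x) (hne : ∀ x ∈ J, u x ≠ 0)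
    (hG : ∀ x, G x = u x * F' x - u' x * F x) : HasZ G N J := by
  classical
  obtain ⟨s, m, h1, h2, h3⟩ := h
  have hs : ∑ x ∈ s with 1 ≤ m x, m x = ∑ x ∈ s, m x := by
    apply Finset.sum_filter_of_ne
    intro x _ hx
    omega
  obtain ⟨t, m', t1, _, t3, t4⟩ := rolle_count hJ hu hF hu' hF' hdu hdF hne m
    (s.filter fun x => 1 ≤ m x) (fun x hx => h1 x (Finset.mem_filter.1 hx).1)
    (fun x hx => (Finset.mem_filter.1 hx).2) (fun x hx => h2 x (Finset.mem_filter.1 hx).1)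
  rw [show G = _ from funext hG]
  exact ⟨t, m', t1, t3, by omega⟩

lemma abs_sin_lt {k z w : ℝ} (hk : 1 < k) (hz : 0 < z) (hz2 : z ≤ Real.pi / 2) (hw : 0 ≤ w)
    (hwk : w ≤ k * z) : |Real.sin w| < k * Real.sin z := by
  have hpi := Real.pi_pos
  rcases le_or_gt (k * z) (Real.pi / 2) with h | h
  · have h0 : 0 ≤ Real.sin w := Real.sin_nonneg_of_nonneg_of_le_pi hw (by linarith)
    rw [abs_of_nonneg h0]
    have h1 : Real.sin w ≤ Real.sin (k * z) :=
      Real.sin_le_sin_of_le_of_le_pi_div_two (by linarith) h hwk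
    have hkz : 0 < k * z := by positivity
    have h2 := strictConcaveOn_sin_Icc.2 (show (0:ℝ) ∈ Set.Icc 0 Real.pi from ⟨le_rfl, hpi.le⟩)
      (show k * z ∈ Set.Icc 0 Real.pi from ⟨hkz.le, by linarith⟩) hkz.ne
      (show 0 < 1 - 1 / k by rw [sub_pos, div_lt_one (by linarith)]; exact hk)
      (show 0 < 1 / k by positivity) (by ring)
    simp only [smul_eq_mul, mul_zero, Real.sin_zero, zero_add] at h2
    have hk0 : k ≠ 0 := by linarith
    rw [show 1 / k * (k * z) = z by field_simp] at h2
    have h3 : k * (1 / k * Real.sin (k * z)) < k * Real.sin z :=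
      mul_lt_mul_of_pos_left h2 (by linarith)
    rw [show k * (1 / k * Real.sin (k * z)) = Real.sin (k * z) by field_simp] at h3
    linarith
  · refine lt_of_le_of_lt (Real.abs_sin_le_one w) ?_
    rcases hz2.lt_or_eq with h2 | h2
    · have h3 := Real.mul_lt_sin hz h2
      have h4 : k * (2 / Real.pi * z) < k * Real.sin z := mul_lt_mul_of_pos_left h3 (by linarith)
      have h5 : k * (2 / Real.pi * z) = (k * z) * (2 / Real.pi) := by ring
      have h6 : Real.pi / 2 * (2 / Real.pi) < (k * z) * (2 / Real.pi) :=
        mul_lt_mul_of_pos_right h (by positivity)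
      rw [show Real.pi / 2 * (2 / Real.pi) = 1 by field_simp] at h6
      linarith
    · rw [h2, Real.sin_pi_div_two]; linarith

lemma g_pos_first {a b x : ℝ} (ha : 0 < a) (hab : a < b) (hx : 0 < x) (hbx : b * x ≤ Real.pi) :
    0 < b * Real.sin (a * x) - a * Real.sin (b * x) := by
  have hb : 0 < b := ha.trans hab
  have hpi := Real.pi_pos
  have hbx0 : 0 < b * x := by positivity
  have h2 := strictConcaveOn_sin_Icc.2 (show (0:ℝ) ∈ Set.Icc 0 Real.pi from ⟨le_rfl, hpi.le⟩)
      (show b * x ∈ Set.Icc 0 Real.pi from ⟨hbx0.le, hbx⟩) hbx0.ne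
      (show 0 < 1 - a / b by rw [sub_pos, div_lt_one hb]; exact hab)
      (show 0 < a / b by positivity) (by ring)
  simp only [smul_eq_mul, mul_zero, Real.sin_zero, zero_add] at h2
  rw [show a / b * (b * x) = a * x by field_simp] at h2
  have h3 := mul_lt_mul_of_pos_left h2 hb
  rw [show b * (a / b * Real.sin (b * x)) = a * Real.sin (b * x) by field_simp] at h3
  linarith

lemma w2_neg {a b x : ℝ} (ha : 0 < a) (hab : a < b) (h3 : b ≤ 3 * a) (hx : 0 < x)
    (h : (b ≤ 2 * a ∧ b * x < 2 * Real.pi) ∨ a * x < Real.pi) :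
    (b * Real.sin (a * x) - a * Real.sin (b * x)) * (-a * Real.sin (a * x) + b * Real.sin (b * x))
      - a * b * (Real.cos (a * x) - Real.cos (b * x)) ^ 2 < 0 := by
  have hpi := Real.pi_pos
  obtain ⟨α, hα⟩ : ∃ α, α = (b - a) / 2 := ⟨_, rfl⟩
  obtain ⟨β, hβ⟩ : ∃ β, β = (b + a) / 2 := ⟨_, rfl⟩
  have ea : a = β - α := by rw [hα, hβ]; ring
  have eb : b = β + α := by rw [hα, hβ]; ring
  have hα0 : 0 < α := by rw [hα]; linarith
  have hαβ : 2 * α ≤ β := by rw [hα, hβ]; linarith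
  have hβ0 : 0 < β := by linarith
  have key : |α * Real.sin (β * x)| < |β * Real.sin (α * x)| := by
    rw [abs_mul, abs_mul, abs_of_pos hα0, abs_of_pos hβ0]
    have main : |Real.sin (β * x)| < β / α * |Real.sin (α * x)| := by
      rcases le_or_gt (α * x) (Real.pi / 2) with hy | hy
      · have := abs_sin_lt (k := β / α) (z := α * x) (w := β * x)
          (by rw [one_lt_div hα0]; linarith) (by positivity) hy (by positivity)
          (by apply le_of_eq; field_simp)
        refine this.trans_le ?_
        exact mul_le_mul_of_nonneg_left (le_abs_self _) (by positivity)
      · have hax : a * x < Real.pi := by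
          rcases h with ⟨h1, h2⟩ | h
          · exfalso
            have : α * x ≤ b * x / 4 := by rw [hα]; nlinarith
            linarith
          · exact h
        have hαx : α * x < Real.pi := by
          have : α ≤ a := by rw [hα]; linarith
          nlinarith
        have hβx : β * x ≤ 2 * Real.pi := by
          have : β ≤ 2 * a := by rw [hβ]; linarith
          nlinarith
        have := abs_sin_lt (k := β / α) (z := Real.pi - α * x) (w := 2 * Real.pi - β * x)
          (by rw [one_lt_div hα0]; linarith) (by linarith) (by linarith) (by linarith)
          (by
            have e : β / α * (Real.pi - α * x) = β / α * Real.pi - β * x := by field_simp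
            have : 2 ≤ β / α := by rw [le_div_iff₀ hα0]; linarith
            rw [e]; nlinarith)
        rw [Real.sin_pi_sub, Real.sin_two_pi_sub, abs_neg] at this
        refine this.trans_le ?_
        exact mul_le_mul_of_nonneg_left (le_abs_self _) (by positivity)
    have := mul_lt_mul_of_pos_left main hα0
    rwa [← mul_assoc, mul_div_cancel₀ _ hα0.ne'] at this
  have k2 := sq_lt_sq.2 key
  have e1 : a * x = β * x - α * x := by rw [ea]; ring
  have e2 : b * x = β * x + α * x := by rw [eb]; ring
  have ident : (b * Real.sin (a * x) - a * Real.sin (b * x)) * (-a * Real.sin (a * x) + b * Real.sin (b * x))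
      - a * b * (Real.cos (a * x) - Real.cos (b * x)) ^ 2 =
      4 * ((α * Real.sin (β * x)) ^ 2 - (β * Real.sin (α * x)) ^ 2) := by
    rw [e1, e2, Real.sin_sub, Real.sin_add, Real.cos_sub, Real.cos_add, ea, eb]
    have c1 := Real.cos_sq' (α * x)
    have c2 := Real.cos_sq' (β * x)
    generalize Real.sin (α * x) = s at *
    generalize Real.sin (β * x) = S at *
    generalize Real.cos (α * x) = c at *
    generalize Real.cos (β * x) = C at *
    have d1 : (C * c + S * s - (C * c - S * s)) ^ 2 = 4 * S ^ 2 * s ^ 2 := by ring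
    rw [d1]
    have d2 : ((β + α) * (S * c - C * s) - (β - α) * (S * c + C * s)) = 2 * α * S * c - 2 * β * C * s := by ring
    have d3 : (-(β - α) * (S * c - C * s) + (β + α) * (S * c + C * s)) = 2 * α * S * c + 2 * β * C * s := by ring
    rw [d2, d3]
    have d4 : (2 * α * S * c - 2 * β * C * s) * (2 * α * S * c + 2 * β * C * s) =
      4 * α ^ 2 * S ^ 2 * c ^ 2 - 4 * β ^ 2 * C ^ 2 * s ^ 2 := by ring
    rw [d4, c1, c2]; ring
  rw [ident]; linarith

lemma g_deriv (a b x : ℝ) : HasDerivAt (fun x => b * Real.sin (a * x) - a * Real.sin (b * x))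
    (a * b * (Real.cos (a * x) - Real.cos (b * x))) x := by
  have h1 : HasDerivAt (fun x => a * x) a x := by simpa using (hasDerivAt_id x).const_mul a
  have h2 : HasDerivAt (fun x => b * x) b x := by simpa using (hasDerivAt_id x).const_mul b
  refine ((h1.sin.const_mul b).sub (h2.sin.const_mul a)).congr_deriv ?_
  ring

lemma g_anti {a b p q : ℝ} (ha : 0 < a) (hab : a < b)
    (h : ∀ x ∈ Set.Ioo p q, Real.cos (a * x) < Real.cos (b * x)) :
    StrictAntiOn (fun x => b * Real.sin (a * x) - a * Real.sin (b * x)) (Set.Icc p q) := by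
  apply strictAntiOn_of_deriv_neg (convex_Icc p q)
  · exact fun x _ => (g_deriv a b x).continuousAt.continuousWithinAt
  · intro x hx
    rw [interior_Icc] at hx
    rw [(g_deriv a b x).deriv]
    have : 0 < a * b := mul_pos ha (ha.trans hab)
    exact mul_neg_of_pos_of_neg this (by linarith [h x hx])

/-- Zero of a strictly decreasing function. -/
lemma g_zero {f : ℝ → ℝ} {p q : ℝ} (hpq : p ≤ q) (hf : ContinuousOn f (Set.Icc p q))
    (hp : 0 < f p) (hq : f q ≤ 0) (hanti : StrictAntiOn f (Set.Icc p q)) :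
    ∃ l ∈ Set.Icc p q, f l = 0 ∧ (∀ x ∈ Set.Icc p q, x < l → 0 < f x) ∧
      ∀ x ∈ Set.Icc p q, f x = 0 → x = l := by
  obtain ⟨l, hl, h0⟩ := intermediate_value_Icc' hpq hf ⟨hq, hp.le⟩
  refine ⟨l, hl, h0, fun x hx hxl => ?_, fun x hx hx0 => ?_⟩
  · have := hanti hx hl hxl
    rwa [h0] at this
  · exact hanti.injOn hx hl (hx0.trans h0.symm)

lemma core_small {a b : ℝ} (ha : 0 < a) (hab : a < b) (h2 : b < 2 * a) :
    ∃ l : ℝ, 0 < l ∧ l ∈ Set.Icc (Real.pi / b * 1) (Real.pi / b * 2) ∧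
      b * Real.sin (a * l) - a * Real.sin (b * l) = 0 ∧
      (∀ x, 0 < x → x < l → 0 < b * Real.sin (a * x) - a * Real.sin (b * x)) ∧
      (∀ x ∈ Set.Icc (Real.pi / b * 1) (Real.pi / b * 2),
        b * Real.sin (a * x) - a * Real.sin (b * x) = 0 → x = l) ∧
      b * l ≤ 2 * Real.pi := by
  have hb : 0 < b := ha.trans hab
  have hpi := Real.pi_pos
  have hpq : Real.pi / a ≤ Real.pi / b * 2 := by
    rw [div_mul_eq_mul_div, div_le_div_iff₀ ha hb]; nlinarith
  have hpa : Real.pi / b * 1 ≤ Real.pi / a := by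
    rw [mul_one]; exact div_le_div_of_nonneg_left hpi.le ha hab.le
  have ea : a * (Real.pi / a) = Real.pi := by field_simp
  have eb : b * (Real.pi / b * 2) = 2 * Real.pi := by field_simp
  have eb1 : b * (Real.pi / b * 1) = Real.pi := by field_simp
  have pos1 : ∀ x, 0 < x → x ≤ Real.pi / a → 0 < b * Real.sin (a * x) - a * Real.sin (b * x) := by
    intro x hx hxa
    rcases le_or_gt (b * x) Real.pi with h | h
    · exact g_pos_first ha hab hx h
    · have hax : a * x ≤ Real.pi := by rw [← ea]; gcongr
      have hbx2 : b * x < 2 * Real.pi := by nlinarith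
      have hsb : Real.sin (b * x) < 0 := by
        have := Real.sin_pos_of_pos_of_lt_pi (x := b * x - Real.pi) (by linarith) (by linarith)
        rw [Real.sin_sub_pi] at this; linarith
      have hsa : 0 ≤ Real.sin (a * x) := Real.sin_nonneg_of_nonneg_of_le_pi (by positivity) hax
      have := mul_nonneg hb.le hsa
      have := mul_neg_of_pos_of_neg ha hsb
      linarith
  have anti := g_anti (p := Real.pi / a) (q := Real.pi / b * 2) ha hab (by
    intro x hx
    have h1 : Real.pi < a * x := by rw [← ea]; exact mul_lt_mul_of_pos_left hx.1 ha
    have h2 : b * x < 2 * Real.pi := by rw [← eb]; exact mul_lt_mul_of_pos_left hx.2 hb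
    have hx0 : 0 < x := lt_trans (by positivity) hx.1
    have h3 : a * x < b * x := mul_lt_mul_of_pos_right hab hx0
    have := Real.cos_lt_cos_of_nonneg_of_le_pi (x := 2 * Real.pi - b * x)
      (y := 2 * Real.pi - a * x) (by linarith) (by linarith) (by linarith)
    rwa [Real.cos_two_pi_sub, Real.cos_two_pi_sub] at this)
  obtain ⟨l, hl, l0, lpos, luniq⟩ := g_zero hpq
    (fun x _ => (g_deriv a b x).continuousAt.continuousWithinAt)
    (pos1 _ (by positivity) le_rfl) (by
      show b * Real.sin (a * (Real.pi / b * 2)) - a * Real.sin (b * (Real.pi / b * 2)) ≤ 0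
      rw [eb, Real.sin_two_pi]
      have h1 : Real.pi ≤ a * (Real.pi / b * 2) := by
        calc Real.pi = a * (Real.pi / a) := ea.symm
          _ ≤ _ := mul_le_mul_of_nonneg_left hpq ha.le
      have h2 : a * (Real.pi / b * 2) ≤ 2 * Real.pi := by rw [← eb]; gcongr
      have := Real.sin_nonneg_of_nonneg_of_le_pi (x := a * (Real.pi / b * 2) - Real.pi) (by linarith) (by linarith)
      rw [Real.sin_sub_pi] at this
      nlinarith) anti
  refine ⟨l, lt_of_lt_of_le (by positivity) hl.1, ⟨hpa.trans hl.1, hl.2⟩, l0, ?_, ?_, ?_⟩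
  · intro x hx hxl
    rcases le_or_gt x (Real.pi / a) with h | h
    · exact pos1 x hx h
    · exact lpos x ⟨h.le, hxl.le.trans hl.2⟩ hxl
  · intro x hx hx0
    rcases le_or_gt x (Real.pi / a) with h | h
    · exact absurd hx0 (pos1 x (lt_of_lt_of_le (by positivity) hx.1) h).ne'
    · exact luniq x ⟨h.le, hx.2⟩ hx0
  · rw [← eb]; exact mul_le_mul_of_nonneg_left hl.2 hb.le

/-- positivity on the first part, `2a ≤ b`. -/
lemma pos_two {a b x : ℝ} (ha : 0 < a) (hab : a < b) (hx : 0 < x)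
    (hax : a * x < Real.pi) (hbx : b * x ≤ 2 * Real.pi) :
    0 < b * Real.sin (a * x) - a * Real.sin (b * x) := by
  have hb : 0 < b := ha.trans hab
  rcases le_or_gt (b * x) Real.pi with h | h
  · exact g_pos_first ha hab hx h
  · have hsb : 0 ≤ Real.sin (b * x - Real.pi) :=
      Real.sin_nonneg_of_nonneg_of_le_pi (by linarith) (by linarith)
    rw [Real.sin_sub_pi] at hsb
    have hsa : 0 < Real.sin (a * x) := Real.sin_pos_of_pos_of_lt_pi (by positivity) hax
    have := mul_pos hb hsa
    nlinarith

lemma core_large {a b : ℝ} (ha : 0 < a) (h2 : 2 * a < b) (h3 : b ≤ 3 * a) :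
    ∃ l : ℝ, 0 < l ∧ l ∈ Set.Icc (Real.pi / b * 2) (Real.pi / a) ∧
      b * Real.sin (a * l) - a * Real.sin (b * l) = 0 ∧
      (∀ x, 0 < x → x < l → 0 < b * Real.sin (a * x) - a * Real.sin (b * x)) ∧
      (∀ x ∈ Set.Icc (Real.pi / b * 2) (Real.pi / b * 3),
        b * Real.sin (a * x) - a * Real.sin (b * x) = 0 → x ≤ Real.pi / a → x = l) ∧
      a * l ≤ Real.pi := by
  have hab : a < b := by linarith
  have hb : 0 < b := ha.trans hab
  have hpi := Real.pi_pos
  have ea : a * (Real.pi / a) = Real.pi := by field_simp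
  have eb : b * (Real.pi / b * 2) = 2 * Real.pi := by field_simp
  have hpq : Real.pi / b * 2 < Real.pi / a := by
    rw [div_mul_eq_mul_div, div_lt_div_iff₀ hb ha]; nlinarith
  have hba : b * (Real.pi / a) ≤ 3 * Real.pi := by
    have : 0 < Real.pi / a := by positivity
    nlinarith
  have hba2 : 2 * Real.pi < b * (Real.pi / a) := by
    rw [← eb]; exact mul_lt_mul_of_pos_left hpq hb
  have anti := g_anti (p := Real.pi / b * 2) (q := Real.pi / a) ha hab (by
    intro x hx
    have hx0 : 0 < x := lt_trans (by positivity) hx.1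
    have h1 : 2 * Real.pi < b * x := by rw [← eb]; exact mul_lt_mul_of_pos_left hx.1 hb
    have h2 : a * x < Real.pi := by
      calc a * x < a * (Real.pi / a) := mul_lt_mul_of_pos_left hx.2 ha
        _ = _ := ea
    have := Real.cos_lt_cos_of_nonneg_of_le_pi (x := Real.pi - a * x)
      (y := 3 * Real.pi - b * x) (by linarith) (by linarith) (by nlinarith)
    rw [Real.cos_pi_sub, show 3 * Real.pi - b * x = Real.pi - b * x + 2 * Real.pi by ring,
      Real.cos_add_two_pi, Real.cos_pi_sub] at this
    linarith)
  have hps : a * (Real.pi / b * 2) < Real.pi := by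
    calc a * (Real.pi / b * 2) < a * (Real.pi / a) := mul_lt_mul_of_pos_left hpq ha
      _ = _ := ea
  obtain ⟨l, hl, l0, lpos, luniq⟩ := g_zero hpq.le
    (fun x _ => (g_deriv a b x).continuousAt.continuousWithinAt)
    (pos_two ha hab (by positivity) hps eb.le) (by
      show b * Real.sin (a * (Real.pi / a)) - a * Real.sin (b * (Real.pi / a)) ≤ 0
      rw [ea, Real.sin_pi]
      have := Real.sin_nonneg_of_nonneg_of_le_pi (x := b * (Real.pi / a) - 2 * Real.pi) (by linarith) (by linarith)
      rw [Real.sin_sub_two_pi] at this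
      nlinarith) anti
  refine ⟨l, lt_of_lt_of_le (by positivity) hl.1, hl, l0, ?_, ?_, ?_⟩
  · intro x hx hxl
    rcases le_or_gt x (Real.pi / b * 2) with h | h
    · refine pos_two ha hab hx ?_ ?_
      · exact lt_of_le_of_lt (mul_le_mul_of_nonneg_left h ha.le) hps
      · rw [← eb]; exact mul_le_mul_of_nonneg_left h hb.le
    · exact lpos x ⟨h.le, hxl.le.trans hl.2⟩ hxl
  · intro x hx hx0 hxa
    exact luniq x ⟨hx.1, hxa⟩ hx0
  · rw [← ea]; exact mul_le_mul_of_nonneg_left hl.2 ha.le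

lemma core {a b : ℝ} (ha : 0 < a) (hab : a < b) (h3 : b ≤ 3 * a) :
    ∃ l : ℝ, 0 < l ∧ l ∈ Set.Icc (Real.pi / b * (⌊b / a⌋ : ℝ)) (Real.pi / b * (⌈b / a⌉ : ℝ)) ∧
      b * Real.sin (a * l) - a * Real.sin (b * l) = 0 ∧
      (∀ x, 0 < x → x < l → 0 < b * Real.sin (a * x) - a * Real.sin (b * x)) ∧
      (∀ x ∈ Set.Icc (Real.pi / b * (⌊b / a⌋ : ℝ)) (Real.pi / b * (⌈b / a⌉ : ℝ)),
        b * Real.sin (a * x) - a * Real.sin (b * x) = 0 → x = l) ∧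
      ((b ≤ 2 * a ∧ b * l ≤ 2 * Real.pi) ∨ a * l ≤ Real.pi) := by
  have hb : 0 < b := ha.trans hab
  have hpi := Real.pi_pos
  rcases lt_trichotomy b (2 * a) with h | h | h
  · have hf : ⌊b / a⌋ = 1 := by
      rw [Int.floor_eq_iff]; push_cast
      rw [le_div_iff₀ ha, div_lt_iff₀ ha]; constructor <;> linarith
    have hc : ⌈b / a⌉ = 2 := by
      rw [Int.ceil_eq_iff]; push_cast
      rw [lt_div_iff₀ ha, div_le_iff₀ ha]; constructor <;> linarith
    rw [hf, hc]
    obtain ⟨l, h1, h2, h3, h4, h5, h6⟩ := core_small ha hab h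
    push_cast
    exact ⟨l, h1, h2, h3, h4, h5, Or.inl ⟨h.le, h6⟩⟩
  · have hba : b / a = 2 := by rw [h]; field_simp
    have hf : ⌊b / a⌋ = 2 := by rw [hba]; norm_num
    have hc : ⌈b / a⌉ = 2 := by rw [hba]; norm_num
    rw [hf, hc]
    push_cast
    have e : Real.pi / b * 2 = Real.pi / a := by rw [h]; field_simp
    have ea : a * (Real.pi / a) = Real.pi := by field_simp
    have eb : b * (Real.pi / a) = 2 * Real.pi := by rw [h]; field_simp
    rw [e]
    refine ⟨Real.pi / a, by positivity, ⟨le_rfl, le_rfl⟩, ?_, ?_, ?_, Or.inr ea.le⟩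
    · rw [ea, eb]; simp
    · intro x hx hxl
      have k1 : a * x < Real.pi := by
        calc a * x < a * (Real.pi / a) := mul_lt_mul_of_pos_left hxl ha
          _ = _ := ea
      exact pos_two ha hab hx k1 (by rw [h]; linarith)
    · intro x hx _
      exact le_antisymm hx.2 hx.1
  · obtain ⟨l, l1, l2, l3, l4, l5, l6⟩ := core_large ha h h3
    have ea : a * (Real.pi / a) = Real.pi := by field_simp
    have hc : ⌈b / a⌉ = 3 := by
      rw [Int.ceil_eq_iff]; push_cast
      rw [lt_div_iff₀ ha, div_le_iff₀ ha]; constructor <;> linarith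
    rcases h3.lt_or_eq with h' | h'
    · have hf : ⌊b / a⌋ = 2 := by
        rw [Int.floor_eq_iff]; push_cast
        rw [le_div_iff₀ ha, div_lt_iff₀ ha]; constructor <;> linarith
      rw [hf, hc]
      push_cast
      have e3 : Real.pi / a ≤ Real.pi / b * 3 := by
        rw [div_mul_eq_mul_div, div_le_div_iff₀ ha hb]; nlinarith
      refine ⟨l, l1, ⟨l2.1, l2.2.trans e3⟩, l3, l4, ?_, Or.inr l6⟩
      intro x hx hx0
      refine l5 x hx hx0 ?_
      by_contra hxa
      push Not at hxa
      have hxp : 0 < x := lt_trans (by positivity) hxa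
      have k1 : Real.pi < a * x := by
        rw [← ea]; exact mul_lt_mul_of_pos_left hxa ha
      have k2 : b * x ≤ 3 * Real.pi := by
        calc b * x ≤ b * (Real.pi / b * 3) := mul_le_mul_of_nonneg_left hx.2 hb.le
          _ = _ := by field_simp
      have k3 : 2 * Real.pi ≤ b * x := by
        calc 2 * Real.pi = b * (Real.pi / b * 2) := by field_simp
          _ ≤ b * x := mul_le_mul_of_nonneg_left hx.1 hb.le
      have k4 : a * x < 2 * Real.pi := by nlinarith
      have s1 := Real.sin_pos_of_pos_of_lt_pi (x := a * x - Real.pi) (by linarith) (by linarith)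
      have s2 := Real.sin_nonneg_of_nonneg_of_le_pi (x := b * x - 2 * Real.pi) (by linarith) (by linarith)
      rw [Real.sin_sub_pi] at s1
      rw [Real.sin_sub_two_pi] at s2
      have := mul_pos hb s1
      have := mul_nonneg ha.le s2
      linarith
    · have hba : b / a = 3 := by rw [h']; field_simp
      have hf : ⌊b / a⌋ = 3 := by rw [hba]; norm_num
      rw [hf, hc]
      push_cast
      have e : Real.pi / b * 3 = Real.pi / a := by rw [h']; field_simp
      have e2 : Real.pi / b * 2 ≤ Real.pi / b * 3 := by gcongr; norm_num
      have hz : b * Real.sin (a * (Real.pi / a)) - a * Real.sin (b * (Real.pi / a)) = 0 := by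
        have e5 : b * (Real.pi / a) = Real.pi + 2 * Real.pi := by rw [h']; field_simp; ring
        rw [ea, e5, Real.sin_add_two_pi]; simp
      have hl : Real.pi / a = l := l5 _ ⟨by rw [← e]; exact e2, e.ge⟩ hz le_rfl
      rw [e]
      refine ⟨l, l1, ⟨hl.le, hl.ge⟩, l3, l4, ?_, Or.inr l6⟩
      intro x hx _
      rw [← hl]; exact le_antisymm hx.2 hx.1

lemma harmonic_repr {y y' : ℝ → ℝ} {ω : ℝ} (hω : ω ≠ 0) (h1 : ∀ x, HasDerivAt y (y' x) x)
    (h2 : ∀ x, HasDerivAt y' (-ω ^ 2 * y x) x) (t x : ℝ) :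
    y x = y t * Real.cos (ω * (x - t)) + y' t / ω * Real.sin (ω * (x - t)) := by
  have hθ : ∀ x, HasDerivAt (fun x => ω * (x - t)) ω x := fun x => by
    simpa using ((hasDerivAt_id x).sub_const t).const_mul ω
  have hP : ∀ x, HasDerivAt (fun x => y x * Real.cos (ω * (x - t)) -
      y' x / ω * Real.sin (ω * (x - t))) 0 x := fun x => by
    refine (((h1 x).mul (hθ x).cos).sub (((h2 x).div_const ω).mul (hθ x).sin)).congr_deriv ?_
    field_simp; ring
  have hQ : ∀ x, HasDerivAt (fun x => y x * Real.sin (ω * (x - t)) +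
      y' x / ω * Real.cos (ω * (x - t))) 0 x := fun x => by
    refine (((h1 x).mul (hθ x).sin).add (((h2 x).div_const ω).mul (hθ x).cos)).congr_deriv ?_
    field_simp; ring
  have cP := is_const_of_deriv_eq_zero (fun x => (hP x).differentiableAt) (fun x => (hP x).deriv) x t
  have cQ := is_const_of_deriv_eq_zero (fun x => (hQ x).differentiableAt) (fun x => (hQ x).deriv) x t
  simp only [sub_self, mul_zero, Real.cos_zero, Real.sin_zero, mul_one, sub_zero, zero_add] at cP cQ
  rw [← cP, ← cQ]
  have := Real.sin_sq_add_cos_sq (ω * (x - t))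
  linear_combination (-y x) * this

lemma ker_repr {a b : ℝ} (ha : a ≠ 0) (hb : b ≠ 0) {F : ℝ → ℝ}
    (hF : F ∈ kerOp 3 ![a ^ 2 * b ^ 2, 0, a ^ 2 + b ^ 2, 0]) (t x : ℝ) :
    (b ^ 2 - a ^ 2) * F x =
      ((iteratedDeriv 2 F t + b ^ 2 * F t) * Real.cos (a * (x - t)) +
        (iteratedDeriv 3 F t + b ^ 2 * iteratedDeriv 1 F t) / a * Real.sin (a * (x - t))) -
      ((iteratedDeriv 2 F t + a ^ 2 * F t) * Real.cos (b * (x - t)) +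
        (iteratedDeriv 3 F t + a ^ 2 * iteratedDeriv 1 F t) / b * Real.sin (b * (x - t))) := by
  obtain ⟨hs, he⟩ := hF
  have hd : ∀ j : ℕ, ∀ x, HasDerivAt (iteratedDeriv j F) (iteratedDeriv (j + 1) F x) x := by
    intro j x
    rw [iteratedDeriv_succ]
    exact ((hs.differentiable_iteratedDeriv j
      (by exact_mod_cast WithTop.coe_lt_top _)) x).hasDerivAt
  have hd0 : ∀ x, HasDerivAt F (iteratedDeriv 1 F x) x := by simpa using hd 0
  have he' : ∀ x, iteratedDeriv 4 F x = -(a ^ 2 * b ^ 2) * F x - (a ^ 2 + b ^ 2) * iteratedDeriv 2 F x := by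
    intro x
    have := he x
    simp [Fin.sum_univ_four] at this
    linarith
  have A := harmonic_repr ha (y := fun x => iteratedDeriv 2 F x + b ^ 2 * F x)
    (y' := fun x => iteratedDeriv 3 F x + b ^ 2 * iteratedDeriv 1 F x)
    (fun x => (hd 2 x).add ((hd0 x).const_mul _))
    (fun x => ((hd 3 x).add ((hd 1 x).const_mul _)).congr_deriv (by
      simp only [he', Nat.reduceAdd]; ring)) t x
  have B := harmonic_repr hb (y := fun x => iteratedDeriv 2 F x + a ^ 2 * F x)
    (y' := fun x => iteratedDeriv 3 F x + a ^ 2 * iteratedDeriv 1 F x)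
    (fun x => (hd 2 x).add ((hd0 x).const_mul _))
    (fun x => ((hd 3 x).add ((hd 1 x).const_mul _)).congr_deriv (by
      simp only [he', Nat.reduceAdd]; ring)) t x
  rw [← A, ← B]; ring

/-- Basis functions. -/
def u1 (a b t x : ℝ) : ℝ := b * Real.sin (a * (x - t)) - a * Real.sin (b * (x - t))
def u2 (a b t x : ℝ) : ℝ := Real.cos (a * (x - t)) - Real.cos (b * (x - t))
def u3 (a b t x : ℝ) : ℝ := -a * Real.sin (a * (x - t)) + b * Real.sin (b * (x - t))
def u4 (a b t x : ℝ) : ℝ := -a ^ 2 * Real.cos (a * (x - t)) + b ^ 2 * Real.cos (b * (x - t))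
def u5 (a b t x : ℝ) : ℝ := a ^ 3 * Real.sin (a * (x - t)) - b ^ 3 * Real.sin (b * (x - t))
def u6 (a b t x : ℝ) : ℝ := a ^ 4 * Real.cos (a * (x - t)) - b ^ 4 * Real.cos (b * (x - t))

lemma aff_deriv (a t x : ℝ) : HasDerivAt (fun x => a * (x - t)) a x := by
  simpa using ((hasDerivAt_id x).sub_const t).const_mul a

lemma u1_deriv (a b t x : ℝ) : HasDerivAt (u1 a b t) (a * b * u2 a b t x) x :=
  (((aff_deriv a t x).sin.const_mul b).sub ((aff_deriv b t x).sin.const_mul a)).congr_deriv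
    (by unfold u2; ring)
lemma u2_deriv (a b t x : ℝ) : HasDerivAt (u2 a b t) (u3 a b t x) x :=
  ((aff_deriv a t x).cos.sub (aff_deriv b t x).cos).congr_deriv (by unfold u3; ring)
lemma u3_deriv (a b t x : ℝ) : HasDerivAt (u3 a b t) (u4 a b t x) x :=
  (((aff_deriv a t x).sin.const_mul (-a)).add ((aff_deriv b t x).sin.const_mul b)).congr_deriv
    (by unfold u4; ring)
lemma u4_deriv (a b t x : ℝ) : HasDerivAt (u4 a b t) (u5 a b t x) x :=
  (((aff_deriv a t x).cos.const_mul (-a ^ 2)).add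
    ((aff_deriv b t x).cos.const_mul (b ^ 2))).congr_deriv (by unfold u5; ring)
lemma u5_deriv (a b t x : ℝ) : HasDerivAt (u5 a b t) (u6 a b t x) x :=
  (((aff_deriv a t x).sin.const_mul (a ^ 3)).sub
    ((aff_deriv b t x).sin.const_mul (b ^ 3))).congr_deriv (by unfold u6; ring)

lemma u1_smooth (a b t : ℝ) : ContDiff ℝ (⊤ : ℕ∞) (u1 a b t) := by unfold u1; fun_prop
lemma u2_smooth (a b t : ℝ) : ContDiff ℝ (⊤ : ℕ∞) (u2 a b t) := by unfold u2; fun_prop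
lemma u3_smooth (a b t : ℝ) : ContDiff ℝ (⊤ : ℕ∞) (u3 a b t) := by unfold u3; fun_prop
lemma u4_smooth (a b t : ℝ) : ContDiff ℝ (⊤ : ℕ∞) (u4 a b t) := by unfold u4; fun_prop
lemma u5_smooth (a b t : ℝ) : ContDiff ℝ (⊤ : ℕ∞) (u5 a b t) := by unfold u5; fun_prop
lemma u6_smooth (a b t : ℝ) : ContDiff ℝ (⊤ : ℕ∞) (u6 a b t) := by unfold u6; fun_prop

lemma ident1 (a b t x : ℝ) :
    (u1 a b t x * u3 a b t x - a * b * u2 a b t x ^ 2) *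
      (u1 a b t x * u5 a b t x - a * b * u3 a b t x ^ 2) -
      (u1 a b t x * u4 a b t x - a * b * u2 a b t x * u3 a b t x) ^ 2 =
    -(b ^ 2 - a ^ 2) ^ 2 * u1 a b t x ^ 2 := by
  unfold u1 u2 u3 u4 u5
  have h1 := Real.cos_sq' (a * (x - t))
  have h2 := Real.cos_sq' (b * (x - t))
  generalize Real.sin (a * (x - t)) = s at *
  generalize Real.sin (b * (x - t)) = S at *
  generalize Real.cos (a * (x - t)) = c at *
  generalize Real.cos (b * (x - t)) = C at *
  grind

lemma ident2 (a b t x : ℝ) :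
    (u1 a b t x * u3 a b t x - a * b * u2 a b t x ^ 2) *
      (u1 a b t x * u6 a b t x - a * b * u3 a b t x * u4 a b t x) -
      (u1 a b t x * u4 a b t x - a * b * u2 a b t x * u3 a b t x) *
      (u1 a b t x * u5 a b t x - a * b * u2 a b t x * u4 a b t x) =
    -(b ^ 2 - a ^ 2) ^ 2 * (a * b) * u1 a b t x * u2 a b t x := by
  unfold u1 u2 u3 u4 u5 u6
  have h1 := Real.cos_sq' (a * (x - t))
  have h2 := Real.cos_sq' (b * (x - t))
  generalize Real.sin (a * (x - t)) = s at *
  generalize Real.sin (b * (x - t)) = S at *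
  generalize Real.cos (a * (x - t)) = c at *
  generalize Real.cos (b * (x - t)) = C at *
  grind

/-- Zero counting for combinations of the basis functions. -/
lemma comb_zero {a b t : ℝ} (hne : b ^ 2 - a ^ 2 ≠ 0) (hab : a * b ≠ 0) {J : Set ℝ} (hJ : J.OrdConnected)
    (h1 : ∀ x ∈ J, u1 a b t x ≠ 0)
    (h2 : ∀ x ∈ J, u1 a b t x * u3 a b t x - a * b * u2 a b t x ^ 2 ≠ 0)
    {c1 c2 c3 c4 : ℝ} {F : ℝ → ℝ}
    (hF : ∀ x, F x = c1 * u1 a b t x + c2 * u2 a b t x + c3 * u3 a b t x + c4 * u4 a b t x)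
    (hz : HasZ F 4 J) : ∀ x, F x = 0 := by
  have s1 := u1_smooth a b t
  have s2 := u2_smooth a b t
  have s3 := u3_smooth a b t
  have s4 := u4_smooth a b t
  have s5 := u5_smooth a b t
  have s6 := u6_smooth a b t
  have d1 := u1_deriv a b t
  have d2 := u2_deriv a b t
  have d3 := u3_deriv a b t
  have d4 := u4_deriv a b t
  have d5 := u5_deriv a b t
  have i1 := ident1 a b t
  have i2 := ident2 a b t
  generalize u1 a b t = v1 at *
  generalize u2 a b t = v2 at *
  generalize u3 a b t = v3 at *
  generalize u4 a b t = v4 at *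
  generalize u5 a b t = v5 at *
  generalize u6 a b t = v6 at *
  have hFe : F = fun x => c1 * v1 x + c2 * v2 x + c3 * v3 x + c4 * v4 x := funext hF
  have hW2 : ∀ x, HasDerivAt (fun x => v1 x * v3 x - a * b * v2 x ^ 2)
      (v1 x * v4 x - a * b * v2 x * v3 x) x := fun x => by
    refine (((d1 x).mul (d3 x)).sub (((d2 x).pow 2).const_mul (a * b))).congr_deriv ?_
    push_cast; ring
  have hA : ∀ x, HasDerivAt (fun x => v1 x * v4 x - a * b * v2 x * v3 x)
      (v1 x * v5 x - a * b * v3 x ^ 2) x := fun x => by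
    refine (((d1 x).mul (d4 x)).sub (((d2 x).const_mul (a * b)).mul (d3 x))).congr_deriv ?_
    ring
  have hB : ∀ x, HasDerivAt (fun x => v1 x * v5 x - a * b * v2 x * v4 x)
      (v1 x * v6 x - a * b * v3 x * v4 x) x := fun x => by
    refine (((d1 x).mul (d5 x)).sub (((d2 x).const_mul (a * b)).mul (d4 x))).congr_deriv ?_
    ring
  have z1 : HasZ (fun x => c2 * (v1 x * v3 x - a * b * v2 x ^ 2) +
      c3 * (v1 x * v4 x - a * b * v2 x * v3 x) + c4 * (v1 x * v5 x - a * b * v2 x * v4 x)) 3 J := by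
    refine HasZ.step (u := v1) (u' := fun x => a * b * v2 x)
      (F' := fun x => c1 * (a * b * v2 x) + c2 * v3 x + c3 * v4 x + c4 * v5 x)
      hz hJ s1 (by rw [hFe]; fun_prop) (by fun_prop) (by fun_prop) d1 ?_ h1 ?_
    · intro x
      rw [hFe]
      exact ((((d1 x).const_mul c1).add ((d2 x).const_mul c2)).add ((d3 x).const_mul c3)).add
        ((d4 x).const_mul c4)
    · intro x
      rw [hF x]; ring
  have z2 : HasZ (fun x => -(b ^ 2 - a ^ 2) ^ 2 * v1 x * (c3 * v1 x + c4 * (a * b) * v2 x)) 2 J := by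
    refine HasZ.step (u := fun x => v1 x * v3 x - a * b * v2 x ^ 2)
      (u' := fun x => v1 x * v4 x - a * b * v2 x * v3 x)
      (F' := fun x => c2 * (v1 x * v4 x - a * b * v2 x * v3 x) +
        c3 * (v1 x * v5 x - a * b * v3 x ^ 2) + c4 * (v1 x * v6 x - a * b * v3 x * v4 x))
      z1 hJ (by fun_prop) (by fun_prop) (by fun_prop) (by fun_prop) hW2 ?_ h2 ?_
    · intro x
      exact (((hW2 x).const_mul c2).add ((hA x).const_mul c3)).add ((hB x).const_mul c4)
    · intro x
      linear_combination (-c3) * i1 x - c4 * i2 x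
  have z3 : HasZ (fun x => -(b ^ 2 - a ^ 2) ^ 2 * c4 * (a * b) * v1 x ^ 2 *
      (v1 x * v3 x - a * b * v2 x ^ 2)) 1 J := by
    refine HasZ.step (u := fun x => v1 x ^ 2)
      (u' := fun x => 2 * v1 x * (a * b * v2 x))
      (F' := fun x => -(b ^ 2 - a ^ 2) ^ 2 * (a * b * v2 x) * (c3 * v1 x + c4 * (a * b) * v2 x) +
        -(b ^ 2 - a ^ 2) ^ 2 * v1 x * (c3 * (a * b * v2 x) + c4 * (a * b) * v3 x))
      z2 hJ (by fun_prop) (by fun_prop) (by fun_prop) (by fun_prop) ?_ ?_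
      (fun x hx => pow_ne_zero 2 (h1 x hx)) ?_
    · intro x
      exact ((d1 x).pow 2).congr_deriv (by push_cast; ring)
    · intro x
      exact ((d1 x).const_mul _).mul (((d1 x).const_mul c3).add ((d2 x).const_mul _))
    · intro x
      ring
  have hk : -(b ^ 2 - a ^ 2) ^ 2 ≠ 0 := neg_ne_zero.2 (pow_ne_zero 2 hne)
  have hc4 : c4 = 0 := by
    obtain ⟨x, hx, h0⟩ := z3.exists_zero
    have k1 := h1 x hx
    have k2 := h2 x hx
    simpa only [mul_eq_zero, hk, hab, k1, k2, pow_eq_zero_iff, ne_eq, false_or, or_false,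
      OfNat.ofNat_ne_zero, not_false_eq_true] using h0
  subst hc4
  have hc3 : c3 = 0 := by
    obtain ⟨x, hx, h0⟩ := z2.exists_zero
    have k1 := h1 x hx
    simpa only [mul_eq_zero, hk, k1, false_or, or_false, zero_mul, add_zero] using h0
  subst hc3
  have hc2 : c2 = 0 := by
    obtain ⟨x, hx, h0⟩ := z1.exists_zero
    have k2 := h2 x hx
    simpa only [mul_eq_zero, k2, false_or, or_false, zero_mul, add_zero] using h0
  subst hc2
  have hc1 : c1 = 0 := by
    obtain ⟨x, hx, h0⟩ := hz.exists_zero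
    have k1 := h1 x hx
    rw [hF x] at h0
    simpa only [mul_eq_zero, k1, false_or, or_false, zero_mul, add_zero] using h0
  subst hc1
  intro x
  rw [hF x]; ring

lemma ec_of_lt_s13 {a b l h : ℝ} (ha : 0 < a) (hab : a < b) (h3 : b ≤ 3 * a)
    (hpos : ∀ x, 0 < x → x < l → 0 < b * Real.sin (a * x) - a * Real.sin (b * x))
    (hl : (b ≤ 2 * a ∧ b * l ≤ 2 * Real.pi) ∨ a * l ≤ Real.pi) (hh : h < l) :
    IsECOn 3 ![a ^ 2 * b ^ 2, 0, a ^ 2 + b ^ 2, 0] (Set.Icc 0 h) := by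
  classical
  have hb : 0 < b := ha.trans hab
  intro F hF hF0 r xs m hxs hinj hm1 hm2 hv
  by_contra hsum
  push Not at hsum
  apply hF0
  have hz : HasZ F 4 (Set.Icc 0 h) := by
    refine ⟨Finset.univ.map ⟨xs, hinj⟩, Function.extend xs m 0, ?_, ?_, ?_⟩
    · intro x hx
      simp only [Finset.mem_map, Finset.mem_univ, true_and, Function.Embedding.coeFn_mk] at hx
      obtain ⟨i, rfl⟩ := hx
      exact hxs i
    · intro x hx
      simp only [Finset.mem_map, Finset.mem_univ, true_and, Function.Embedding.coeFn_mk] at hx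
      obtain ⟨i, rfl⟩ := hx
      rw [hinj.extend_apply]
      exact hv i
    · rw [Finset.sum_map]
      simp only [Function.Embedding.coeFn_mk, hinj.extend_apply]
      omega
  obtain ⟨t, ht⟩ : ∃ t, t = -((l - h) / 2) := ⟨_, rfl⟩
  have hx : ∀ x ∈ Set.Icc 0 h, 0 < x - t ∧ x - t < l := by
    intro x hx
    rw [ht]
    constructor <;> linarith [hx.1, hx.2]
  have hne : b ^ 2 - a ^ 2 ≠ 0 := by
    have : 0 < b ^ 2 - a ^ 2 := by nlinarith
    exact this.ne'
  have key := ker_repr ha.ne' hb.ne' hF t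
  generalize iteratedDeriv 1 F t = f1 at key
  generalize iteratedDeriv 2 F t = f2 at key
  generalize iteratedDeriv 3 F t = f3 at key
  generalize F t = f0 at key
  have rep : ∀ x, F x =
      (((f3 + b ^ 2 * f1) / a * b - (f3 + a ^ 2 * f1) / b * a) / (b ^ 2 - a ^ 2) ^ 2) * u1 a b t x +
      (((f2 + b ^ 2 * f0) * b ^ 2 - (f2 + a ^ 2 * f0) * a ^ 2) / (b ^ 2 - a ^ 2) ^ 2) * u2 a b t x +
      (((f3 + b ^ 2 * f1) / a * a - (f3 + a ^ 2 * f1) / b * b) / (b ^ 2 - a ^ 2) ^ 2) * u3 a b t x +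
      (((f2 + b ^ 2 * f0) - (f2 + a ^ 2 * f0)) / (b ^ 2 - a ^ 2) ^ 2) * u4 a b t x := by
    intro x
    have k := key x
    have e : F x = ((b ^ 2 - a ^ 2) * ((b ^ 2 - a ^ 2) * F x)) / (b ^ 2 - a ^ 2) ^ 2 := by
      field_simp
    rw [e, k]
    unfold u1 u2 u3 u4
    generalize (f3 + b ^ 2 * f1) / a = p
    generalize (f3 + a ^ 2 * f1) / b = q
    field_simp
    ring
  funext x
  refine comb_zero hne (mul_pos ha hb).ne' Set.ordConnected_Icc ?_ ?_ rep hz x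
  · intro x hxJ
    obtain ⟨k1, k2⟩ := hx x hxJ
    exact (hpos _ k1 k2).ne'
  · intro x hxJ
    obtain ⟨k1, k2⟩ := hx x hxJ
    refine (w2_neg ha hab h3 k1 ?_).ne
    rcases hl with ⟨q1, q2⟩ | q
    · exact Or.inl ⟨q1, lt_of_lt_of_le (mul_lt_mul_of_pos_left k2 hb) q2⟩
    · exact Or.inr (lt_of_lt_of_le (mul_lt_mul_of_pos_left k2 ha) q)

lemma u1_iter (a b t : ℝ) : iteratedDeriv 1 (u1 a b t) = (fun x => a * b * u2 a b t x) ∧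
    iteratedDeriv 2 (u1 a b t) = (fun x => a * b * u3 a b t x) ∧
    iteratedDeriv 3 (u1 a b t) = (fun x => a * b * u4 a b t x) ∧
    iteratedDeriv 4 (u1 a b t) = (fun x => a * b * u5 a b t x) := by
  have e1 : iteratedDeriv 1 (u1 a b t) = (fun x => a * b * u2 a b t x) := by
    rw [iteratedDeriv_one]; exact funext fun x => (u1_deriv a b t x).deriv
  have e2 : iteratedDeriv 2 (u1 a b t) = (fun x => a * b * u3 a b t x) := by
    rw [iteratedDeriv_succ, e1]; exact funext fun x => ((u2_deriv a b t x).const_mul _).deriv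
  have e3 : iteratedDeriv 3 (u1 a b t) = (fun x => a * b * u4 a b t x) := by
    rw [iteratedDeriv_succ, e2]; exact funext fun x => ((u3_deriv a b t x).const_mul _).deriv
  have e4 : iteratedDeriv 4 (u1 a b t) = (fun x => a * b * u5 a b t x) := by
    rw [iteratedDeriv_succ, e3]; exact funext fun x => ((u4_deriv a b t x).const_mul _).deriv
  exact ⟨e1, e2, e3, e4⟩

lemma u1_mem (a b t : ℝ) : u1 a b t ∈ kerOp 3 ![a ^ 2 * b ^ 2, 0, a ^ 2 + b ^ 2, 0] := by
  refine ⟨u1_smooth a b t, fun x => ?_⟩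
  obtain ⟨e1, e2, e3, e4⟩ := u1_iter a b t
  simp [Fin.sum_univ_four, e2, e4]
  unfold u1 u3 u5
  ring

lemma not_ec_s13 {a b l h : ℝ} (ha : 0 < a) (hab : a < b) (hl : 0 < l)
    (h0 : b * Real.sin (a * l) - a * Real.sin (b * l) = 0)
    (hpos : ∀ x, 0 < x → x < l → 0 < b * Real.sin (a * x) - a * Real.sin (b * x))
    (hh : l ≤ h) : ¬ IsECOn 3 ![a ^ 2 * b ^ 2, 0, a ^ 2 + b ^ 2, 0] (Set.Icc 0 h) := by
  intro hec
  have hne : u1 a b 0 ≠ 0 := by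
    intro e
    have k := hpos (l / 2) (by linarith) (by linarith)
    have k' := congrFun e (l / 2)
    simp [u1] at k'
    linarith
  obtain ⟨e1, e2, e3, e4⟩ := u1_iter a b 0
  have := hec _ (u1_mem a b 0) hne 2 ![0, l] ![3, 1] (by
      intro i; fin_cases i
      · exact ⟨le_rfl, by simp; linarith⟩
      · exact ⟨hl.le, hh⟩) (by
      intro i j hij
      fin_cases i <;> fin_cases j <;> simp_all [hl.ne']) (by
      intro i; fin_cases i <;> simp) (by
      intro i; fin_cases i <;> simp) (by
      intro i; fin_cases i
      · intro j hj
        simp at hj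
        interval_cases j
        · simp [u1]
        · simp [e1, u2]
        · simp [e2, u3]
      · intro j hj
        simp at hj
        subst hj
        simpa [u1] using h0)
  simp at this

/-- for `0 < a < b ≤ 3a`, the critical length `ℓ` of `(D² + a²)(D² + b²)`
(kernel spanned by `cos ax, sin ax, cos bx, sin bx`) is the first positive zero of `S₃`, and
is the unique solution of `b sin(ax) = a sin(bx)` in `[(π/b)⌊b/a⌋, (π/b)⌈b/a⌉]`. -/
theorem stmt13 (a b : ℝ) (ha : 0 < a) (hab : a < b) (h3 : b ≤ 3 * a) :
    ∃ ℓ : ℝ, critLen 3 ![a ^ 2 * b ^ 2, 0, a ^ 2 + b ^ 2, 0] = (ℓ : EReal) ∧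
      (∀ S ∈ kerOp 3 ![a ^ 2 * b ^ 2, 0, a ^ 2 + b ^ 2, 0],
        (∀ j < 3, iteratedDeriv j S 0 = 0) → iteratedDeriv 3 S 0 = 1 →
          S ℓ = 0 ∧ ∀ x : ℝ, 0 < x → x < ℓ → S x ≠ 0) ∧
      ℓ ∈ Set.Icc (Real.pi / b * (⌊b / a⌋ : ℝ)) (Real.pi / b * (⌈b / a⌉ : ℝ)) ∧
      b * Real.sin (a * ℓ) = a * Real.sin (b * ℓ) ∧
      ∀ x ∈ Set.Icc (Real.pi / b * (⌊b / a⌋ : ℝ)) (Real.pi / b * (⌈b / a⌉ : ℝ)),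
        b * Real.sin (a * x) = a * Real.sin (b * x) → x = ℓ := by
  obtain ⟨l, l0, lI, lz, lpos, luniq, lbd⟩ := core ha hab h3
  have hb : 0 < b := ha.trans hab
  have hD : 0 < b ^ 2 - a ^ 2 := by nlinarith
  refine ⟨l, ?_, ?_, lI, by linarith, fun x hx hx0 => luniq x hx (by linarith)⟩
  · apply sSup_eq_of_forall_le_of_forall_lt_exists_gt
    · rintro _ ⟨h, rfl, hh, hec⟩
      rw [EReal.coe_le_coe_iff]
      by_contra hlt
      push Not at hlt
      exact not_ec_s13 ha hab l0 lz lpos hlt.le hec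
    · intro w hw
      obtain ⟨r, hr1, hr2⟩ := EReal.lt_iff_exists_real_btwn.1 hw
      rw [EReal.coe_lt_coe_iff] at hr2
      refine ⟨((max r (l / 2) : ℝ) : EReal), ⟨max r (l / 2), rfl, ?_, ?_⟩, ?_⟩
      · exact lt_of_lt_of_le (by linarith) (le_max_right _ _)
      · exact ec_of_lt_s13 ha hab h3 lpos lbd (max_lt hr2 (by linarith))
      · exact lt_of_lt_of_le hr1 (EReal.coe_le_coe_iff.2 (le_max_left _ _))
  · intro S hS hS0 hS3
    have k0 : S 0 = 0 := by simpa using hS0 0 (by norm_num)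
    have k1 := hS0 1 (by norm_num)
    have k2 := hS0 2 (by norm_num)
    have key : ∀ x, (a * b * (b ^ 2 - a ^ 2)) * S x = b * Real.sin (a * x) - a * Real.sin (b * x) := by
      intro x
      have := ker_repr ha.ne' hb.ne' hS 0 x
      rw [k0, k1, k2, hS3, sub_zero] at this
      rw [mul_assoc, this]
      field_simp
      ring
    have hc : 0 < a * b * (b ^ 2 - a ^ 2) := by positivity
    constructor
    · have := key l
      rw [lz] at this
      exact (mul_eq_zero.1 this).resolve_left hc.ne'
    · intro x hx hxl hSx
      have := key x
      rw [hSx, mul_zero] at this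
      linarith [lpos x hx hxl]
end
end
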